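/- arXiv:1403.0691 — 9 statements merged into one kernel-verified Lean document; each statement's English description precedes it below -/
import Mathlib

section
/- lim_{n→∞} ( α_n({21-34, 34-21}) / n! )^{1/n} = 1/(2·log 2). -/
/-- `π ∈ S_n` contains the generalized pattern 21-34: there are 1-indexed positions
`1 ≤ i < i+1 < j < j+1 ≤ n` (here 0-indexed) with `π(i+1) < π(i) < π(j) < π(j+1)`. -/
def Contains2134 {n : ℕ} (π : Equiv.Perm (Fin n)) : Prop :=
  ∃ i j : ℕ, ∃ h1 : i + 1 < j, ∃ h2 : j + 1 < n,
    π ⟨i + 1, by omega⟩ < π ⟨i, by omega⟩ ∧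
    π ⟨i, by omega⟩ < π ⟨j, by omega⟩ ∧
    π ⟨j, by omega⟩ < π ⟨j + 1, h2⟩

/-- `π ∈ S_n` contains the generalized pattern 34-21: there are 1-indexed positions
`1 ≤ i < i+1 < j < j+1 ≤ n` (here 0-indexed) with `π(j+1) < π(j) < π(i) < π(i+1)`. -/
def Contains3421 {n : ℕ} (π : Equiv.Perm (Fin n)) : Prop :=
  ∃ i j : ℕ, ∃ h1 : i + 1 < j, ∃ h2 : j + 1 < n,
    π ⟨j + 1, h2⟩ < π ⟨j, by omega⟩ ∧
    π ⟨j, by omega⟩ < π ⟨i, by omega⟩ ∧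
    π ⟨i, by omega⟩ < π ⟨i + 1, by omega⟩

/-- `α_n({21-34, 34-21})`: the number of `π ∈ S_n` avoiding both 21-34 and 34-21. -/
noncomputable def avoidCount (n : ℕ) : ℕ :=
  Nat.card {π : Equiv.Perm (Fin n) // ¬ Contains2134 π ∧ ¬ Contains3421 π}

open Finset

/-- The number of surjections from an `a`-element set onto a `j`-element set. -/
noncomputable def surjCount (a j : ℕ) : ℕ :=
  Nat.card {f : Fin a → Fin j // Function.Surjective f}

theorem card_surjective_eq_surjCount (α : Type*) [Fintype α] (j : ℕ) :
    Nat.card {f : α → Fin j // Function.Surjective f} = surjCount (Fintype.card α) j := by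
  refine Nat.card_congr (((Fintype.equivFin α).arrowCongr (Equiv.refl _)).subtypeEquiv ?_)
  intro f
  simp [Equiv.arrowCongr]

theorem surjCount_zero_zero : surjCount 0 0 = 1 := by
  rw [surjCount, Nat.card_eq_one_iff_unique]
  exact ⟨inferInstance, ⟨⟨id, Function.surjective_id⟩⟩⟩

theorem surjCount_zero_right {a : ℕ} (ha : 0 < a) : surjCount a 0 = 0 := by
  have : IsEmpty {f : Fin a → Fin 0 // Function.Surjective f} :=
    ⟨fun f => (f.1 ⟨0, ha⟩).elim0⟩
  exact Nat.card_of_isEmpty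

theorem surjCount_le_surjCount_succ (a j : ℕ) :
    surjCount a (j + 1) ≤ surjCount (a + 1) (j + 1) := by
  refine Nat.card_le_card_of_injective
    (fun f => ⟨Fin.cons 0 f.1, fun y => ?_⟩) ?_
  · obtain ⟨x, hx⟩ := f.2 y
    exact ⟨x.succ, by simpa using hx⟩
  · intro f g h
    simpa [Subtype.ext_iff] using h

/-- Splitting off the fibre over the last element. -/
theorem surjCount_succ (a j : ℕ) :
    surjCount a (j + 1) = ∑ i ∈ range a, a.choose i * surjCount i j := by
  classical
  let G : (Σ s : Finset (Fin a), {g : s → Fin j // Function.Surjective g ∧ s ≠ univ}) →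
      {f : Fin a → Fin (j + 1) // Function.Surjective f} := fun x =>
    ⟨fun v => if hv : v ∈ x.1 then (x.2.1 ⟨v, hv⟩).castSucc else Fin.last j, by
      obtain ⟨s, g, hg, hs⟩ := x
      intro y
      induction y using Fin.lastCases with
      | last =>
        obtain ⟨v, hv⟩ : ∃ v, v ∉ s := by
          by_contra! h
          exact hs (eq_univ_iff_forall.2 h)
        exact ⟨v, by simp [hv]⟩
      | cast y =>
        obtain ⟨v, rfl⟩ := hg y
        exact ⟨v, by simp⟩⟩
  have hG : Function.Bijective G := by
    constructor
    · rintro ⟨s, g, hg, hs⟩ ⟨t, g', hg', ht⟩ h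
      have h' := congrFun (congrArg Subtype.val h)
      simp only [G] at h'
      obtain rfl : s = t := by
        ext v
        have := h' v
        by_cases h1 : v ∈ s <;> by_cases h2 : v ∈ t <;> simp [h1, h2] at this ⊢
        all_goals exact absurd this.symm (Fin.castSucc_ne_last _)
      obtain rfl : g = g' := by
        ext v : 1
        simpa using h' v
      rfl
    · rintro ⟨f, hf⟩
      refine ⟨⟨univ.filter (f · ≠ Fin.last j),
        fun v => (f v).castPred (mem_filter.1 v.2).2, ?_, ?_⟩, ?_⟩
      · intro y
        obtain ⟨v, hv⟩ := hf y.castSucc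
        exact ⟨⟨v, by simp [hv, Fin.castSucc_ne_last]⟩, by simp [hv]⟩
      · intro h
        obtain ⟨v, hv⟩ := hf (Fin.last j)
        have := eq_univ_iff_forall.1 h v
        simp [hv] at this
      · apply Subtype.ext
        funext v
        by_cases hv : f v = Fin.last j <;> simp [G, hv]
  have hs (s : Finset (Fin a)) :
      Nat.card {g : s → Fin j // Function.Surjective g ∧ s ≠ univ} =
        if #s < a then surjCount #s j else 0 := by
    have hs' : s ≠ univ ↔ #s < a := by
      rw [← card_lt_iff_ne_univ, Fintype.card_fin]
    split_ifs with h
    · simp only [hs'.2 h, ne_eq, not_false_eq_true, and_true]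
      rw [card_surjective_eq_surjCount, Fintype.card_coe]
    · have : IsEmpty {g : s → Fin j // Function.Surjective g ∧ s ≠ univ} :=
        ⟨fun g => h (hs'.1 g.2.2)⟩
      exact Nat.card_of_isEmpty
  rw [surjCount, ← Nat.card_eq_of_bijective G hG, Nat.card_sigma]
  simp only [hs]
  have := sum_powerset_apply_card (x := (univ : Finset (Fin a)))
    (fun m => if m < a then surjCount m j else 0)
  rw [powerset_univ] at this
  rw [this, card_univ, Fintype.card_fin, sum_range_succ]
  simp only [lt_irrefl, smul_eq_mul, mul_zero, if_false, add_zero]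
  exact sum_congr rfl fun i hi => by rw [if_pos (mem_range.1 hi)]

theorem surjCount_div_factorial_succ (a j : ℕ) :
    (surjCount a (j + 1) : ℝ) / a.factorial =
      ∑ i ∈ range a, (surjCount i j : ℝ) / i.factorial * (1 / (a - i).factorial) := by
  rw [surjCount_succ]
  push_cast
  rw [sum_div]
  refine sum_congr rfl fun i hi => ?_
  rw [Nat.cast_choose ℝ (mem_range.1 hi).le]
  have := a.factorial_ne_zero
  field_simp

theorem sum_range_pow_div_factorial_sub (a : ℕ) (x : ℝ) :
    ∑ i ∈ range a, x ^ (a - i) / (a - i).factorial =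
      ∑ i ∈ range (a + 1), x ^ i / i.factorial - 1 := by
  rw [sum_range_succ', ← sum_range_reflect]
  simp only [pow_zero, Nat.factorial_zero, Nat.cast_one, div_one, add_sub_cancel_right]
  refine sum_congr rfl fun i hi => ?_
  have := mem_range.1 hi
  rw [show a - (a - 1 - i) = i + 1 by omega]

theorem surjCount_mul_pow_le {x : ℝ} (hx : 0 ≤ x) (a j : ℕ) :
    (surjCount a j : ℝ) / a.factorial * x ^ a ≤ (Real.exp x - 1) ^ j := by
  have h0 : 0 ≤ Real.exp x - 1 := by linarith [Real.one_le_exp hx]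
  induction j generalizing a with
  | zero =>
    rcases Nat.eq_zero_or_pos a with rfl | ha
    · simp [surjCount_zero_zero]
    · simp [surjCount_zero_right ha]
  | succ j ih =>
    rw [surjCount_div_factorial_succ, sum_mul]
    calc _ ≤ ∑ i ∈ range a, (Real.exp x - 1) ^ j * (x ^ (a - i) / (a - i).factorial) := by
          refine sum_le_sum fun i hi => ?_
          rw [show x ^ a = x ^ i * x ^ (a - i) by
            rw [← pow_add, Nat.add_sub_cancel' (mem_range.1 hi).le]]
          calc _ = ((surjCount i j : ℝ) / i.factorial * x ^ i) *
                (x ^ (a - i) / (a - i).factorial) := by ring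
            _ ≤ _ := by gcongr; exact ih i
      _ = (Real.exp x - 1) ^ j * (∑ i ∈ range (a + 1), x ^ i / i.factorial - 1) := by
          rw [← mul_sum, sum_range_pow_div_factorial_sub]
      _ ≤ _ := by
          rw [pow_succ]
          gcongr
          exact Real.sum_le_exp_of_nonneg hx _

theorem two_sub_inv_le_sum_log_two_pow {a : ℕ} (ha : 1 ≤ a) :
    2 - 1 / ((a : ℝ) + 1) ≤ ∑ i ∈ range (a + 1), Real.log 2 ^ i / i.factorial := by
  have hL0 : 0 ≤ Real.log 2 := Real.log_nonneg (by norm_num)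
  have hL : Real.log 2 < 0.6931471808 := Real.log_two_lt_d9
  have h := Real.exp_bound' hL0 (by linarith) (n := a + 1) (by omega)
  rw [Real.exp_log (by norm_num)] at h
  have h1 : Real.log 2 ^ (a + 1) ≤ 1 / 2 := by
    calc _ ≤ Real.log 2 ^ 2 := pow_le_pow_of_le_one hL0 (by linarith) (by omega)
      _ ≤ _ := by nlinarith
  have h2 : ((a + 1 : ℕ) : ℝ) ≤ (a + 1).factorial := by exact_mod_cast Nat.self_le_factorial _
  have h3 : Real.log 2 ^ (a + 1) * ((a + 1 : ℕ) + 1) / ((a + 1).factorial * (a + 1 : ℕ)) ≤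
      1 / ((a : ℝ) + 1) := by
    push_cast at h2 ⊢
    rw [div_le_div_iff₀ (by positivity) (by positivity)]
    have ha' : (1 : ℝ) ≤ a := by exact_mod_cast ha
    have : Real.log 2 ^ (a + 1) * ((a : ℝ) + 1 + 1) ≤ (a + 1).factorial := by nlinarith
    nlinarith
  linarith

theorem inv_le_sum_surjCount (a : ℕ) :
    1 / ((a : ℝ) + 1) ≤
      (∑ j ∈ range (a + 1), (surjCount a j : ℝ) / a.factorial) * Real.log 2 ^ a := by
  have hL0 : 0 ≤ Real.log 2 := Real.log_nonneg (by norm_num)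
  induction a using Nat.strong_induction_on with
  | _ a ih =>
    rcases Nat.eq_zero_or_pos a with rfl | ha
    · simp [surjCount_zero_zero]
    have ha' : (0 : ℝ) < a := by exact_mod_cast ha
    rw [sum_range_succ', surjCount_zero_right ha]
    simp only [surjCount_div_factorial_succ]
    rw [sum_comm]
    calc 1 / ((a : ℝ) + 1) = 1 / a * (2 - 1 / ((a : ℝ) + 1) - 1) := by field_simp; ring
      _ ≤ 1 / a * (∑ i ∈ range (a + 1), Real.log 2 ^ i / i.factorial - 1) := by
          gcongr
          exact two_sub_inv_le_sum_log_two_pow ha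
      _ = ∑ i ∈ range a, 1 / (a : ℝ) * (Real.log 2 ^ (a - i) / (a - i).factorial) := by
          rw [← sum_range_pow_div_factorial_sub, mul_sum]
      _ ≤ ∑ i ∈ range a, ((∑ j ∈ range (i + 1), (surjCount i j : ℝ) / i.factorial) *
            Real.log 2 ^ i) * (Real.log 2 ^ (a - i) / (a - i).factorial) := by
          refine sum_le_sum fun i hi => ?_
          have hi := mem_range.1 hi
          gcongr
          refine le_trans ?_ (ih i hi)
          have : (i : ℝ) + 1 ≤ a := by exact_mod_cast hi
          gcongr
      _ ≤ _ := by
          rw [Nat.cast_zero, zero_div, add_zero, sum_mul]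
          refine sum_le_sum fun i hi => ?_
          have hi := mem_range.1 hi
          rw [← sum_mul, show Real.log 2 ^ a = Real.log 2 ^ i * Real.log 2 ^ (a - i) by
            rw [← pow_add, Nat.add_sub_cancel' hi.le]]
          calc _ = (∑ j ∈ range (i + 1), (surjCount i j : ℝ) / i.factorial) *
                (1 / (a - i).factorial) * (Real.log 2 ^ i * Real.log 2 ^ (a - i)) := by ring
            _ ≤ _ := by
              gcongr
              exact hi

theorem exists_le_surjCount (a : ℕ) :
    ∃ j, (a.factorial : ℝ) / (((a : ℝ) + 1) ^ 2 * Real.log 2 ^ a) ≤ surjCount a j := by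
  have hL0 : 0 < Real.log 2 := Real.log_pos (by norm_num)
  by_contra! h
  have h1 := inv_le_sum_surjCount a
  have h2 : ∑ j ∈ range (a + 1), (surjCount a j : ℝ) / a.factorial <
      ∑ j ∈ range (a + 1), 1 / (((a : ℝ) + 1) ^ 2 * Real.log 2 ^ a) := by
    refine sum_lt_sum_of_nonempty (by simp) fun j _ => ?_
    rw [div_lt_iff₀ (by positivity)]
    exact (h j).trans_eq (by ring)
  have h3 := mul_lt_mul_of_pos_right h2 (pow_pos hL0 a)
  refine absurd (h1.trans_lt h3) (not_lt.2 (le_of_eq ?_))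
  rw [sum_const, card_range, nsmul_eq_mul]
  push_cast
  field_simp

/-- At every position but the last, values below `k` are ascent bottoms and the others are
descent tops. -/
def IsThreshold {N : ℕ} (k : ℕ) (π : Equiv.Perm (Fin (N + 1))) : Prop :=
  ∀ i : Fin N, ((π i.castSucc : ℕ) < k → π i.castSucc < π i.succ) ∧
    (k ≤ (π i.castSucc : ℕ) → π i.succ < π i.castSucc)

theorem avoids_iff {N : ℕ} (π : Equiv.Perm (Fin (N + 1))) :
    (¬ Contains2134 π ∧ ¬ Contains3421 π) ↔
      ∀ i j : Fin N, π i.succ < π i.castSucc → π j.castSucc < π j.succ →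
        π j.castSucc < π i.castSucc := by
  constructor
  · rintro ⟨h1, h2⟩ i j hi hj
    by_contra! h
    rcases lt_trichotomy i j with hij | rfl | hij
    · rcases eq_or_ne ((i : ℕ) + 1) j with he | he
      · have : i.succ = j.castSucc := Fin.ext (by simpa using he)
        rw [this] at hi
        exact absurd hi (not_lt.2 h)
      · refine h1 ⟨i, j, by have := Fin.lt_def.1 hij; omega, by omega, hi, lt_of_le_of_ne h ?_, hj⟩
        exact π.injective.ne (by simpa [Fin.ext_iff] using hij.ne)
    · exact absurd hi (not_lt.2 hj.le)
    · rcases eq_or_ne ((j : ℕ) + 1) i with he | he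
      · have : j.succ = i.castSucc := Fin.ext (by simpa using he)
        rw [this] at hj
        exact absurd hj (not_lt.2 h)
      · refine h2 ⟨j, i, by have := Fin.lt_def.1 hij; omega, by omega, hi, lt_of_le_of_ne h ?_, hj⟩
        exact π.injective.ne (by simpa [Fin.ext_iff] using hij.ne')
  · intro h
    constructor
    · rintro ⟨i, j, h1, h2, ha, hb, hc⟩
      exact absurd (h ⟨i, by omega⟩ ⟨j, by omega⟩ ha hc) (not_lt.2 hb.le)
    · rintro ⟨i, j, h1, h2, ha, hb, hc⟩
      exact absurd (h ⟨j, by omega⟩ ⟨i, by omega⟩ ha hc) (not_lt.2 hb.le)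

theorem avoids_iff_exists_isThreshold {N : ℕ} (π : Equiv.Perm (Fin (N + 1))) :
    (¬ Contains2134 π ∧ ¬ Contains3421 π) ↔ ∃ k ≤ N + 1, IsThreshold k π := by
  rw [avoids_iff]
  constructor
  · intro h
    obtain ⟨k, hk⟩ : ∃ k, k = (univ.filter fun j : Fin N => π j.castSucc < π j.succ).sup
      fun j => (π j.castSucc : ℕ) + 1 := ⟨_, rfl⟩
    refine ⟨k, hk ▸ Finset.sup_le fun j _ => by omega, fun i => ⟨?_, ?_⟩⟩
    · intro hi
      rw [hk] at hi
      obtain ⟨j, hj, hij⟩ := Finset.lt_sup_iff.1 hi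
      simp only [mem_filter, mem_univ, true_and] at hj
      by_contra! hi'
      have hne : π i.succ ≠ π i.castSucc := π.injective.ne (Fin.castSucc_lt_succ).ne'
      have := Fin.lt_def.1 (h i j (lt_of_le_of_ne hi' hne) hj)
      omega
    · intro hi
      by_contra! hi'
      have hne : π i.castSucc ≠ π i.succ := π.injective.ne (Fin.castSucc_lt_succ).ne
      have := Finset.le_sup (f := fun j : Fin N => (π j.castSucc : ℕ) + 1)
        (mem_filter.2 ⟨mem_univ i, lt_of_le_of_ne hi' hne⟩ :
          i ∈ univ.filter fun j : Fin N => π j.castSucc < π j.succ)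
      rw [← hk] at this
      omega
  · rintro ⟨k, -, hk⟩ i j hi hj
    have h1 : k ≤ (π i.castSucc : ℕ) := by
      by_contra! h
      exact absurd ((hk i).1 h) (not_lt.2 hi.le)
    have h2 : (π j.castSucc : ℕ) < k := by
      by_contra! h
      exact absurd ((hk j).2 h) (not_lt.2 hj.le)
    exact Fin.lt_def.2 (h2.trans_le h1)

/-- Sorting by this key puts the blocks `h⁻¹ {0}, h⁻¹ {1}, …` one after the other, with the values
below `k` increasing and the others decreasing inside each block. -/
def blockKey {n r : ℕ} (k : ℕ) (h : Fin n → Fin r) (v : Fin n) : ℕ ×ₗ ℤ :=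
  toLex ((h v : ℕ), if (v : ℕ) < k then (v : ℤ) else -(v : ℤ))

theorem perm_eq_of_strictMono_comp {n : ℕ} {β : Type*} [LinearOrder β] {K : Fin n → β}
    {π ρ : Equiv.Perm (Fin n)} (hπ : StrictMono (K ∘ π)) (hρ : StrictMono (K ∘ ρ)) : π = ρ := by
  have h : K ∘ π = K ∘ ρ := by
    rw [← hπ.range_inj hρ, π.surjective.range_comp, ρ.surjective.range_comp]
  have hK : Function.Injective K := by
    intro a b hab
    obtain ⟨a, rfl⟩ := π.surjective a
    obtain ⟨b, rfl⟩ := π.surjective b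
    rw [hπ.injective hab]
  ext1 i
  exact hK (congrFun h i)

/-- Labellings of `α` by consecutive integers starting at `0`, with the elements satisfying `p`
getting the even labels. -/
abbrev ParityLabelling {α : Type*} (p : α → Prop) (r : ℕ) : Type _ :=
  {h : α → Fin r // Function.Surjective h ∧ ∀ v, Even (h v : ℕ) ↔ p v}

theorem card_parityLabelling_le {α : Type*} [Fintype α] (p : α → Prop) [DecidablePred p] (r : ℕ) :
    Nat.card (ParityLabelling p r) ≤
      surjCount (Fintype.card {v // p v}) ((r + 1) / 2) *
        surjCount (Fintype.card {v // ¬ p v}) (r / 2) := by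
  rw [← card_surjective_eq_surjCount, ← card_surjective_eq_surjCount, ← Nat.card_prod]
  let F : ParityLabelling p r →
      {f : {v // p v} → Fin ((r + 1) / 2) // Function.Surjective f} ×
      {f : {v // ¬ p v} → Fin (r / 2) // Function.Surjective f} := fun h =>
    (⟨fun v => ⟨(h.1 v : ℕ) / 2, by have := (h.1 v).2; omega⟩, fun m => by
        obtain ⟨v, hv⟩ := h.2.1 ⟨2 * m, by omega⟩
        exact ⟨⟨v, (h.2.2 v).1 (by simp [hv])⟩, by simp [hv]⟩⟩,
     ⟨fun v => ⟨(h.1 v : ℕ) / 2, by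
        have := (h.1 v).2
        have := Nat.odd_iff.1 (Nat.not_even_iff_odd.1 (mt (h.2.2 v).1 v.2))
        omega⟩, fun m => by
        obtain ⟨v, hv⟩ := h.2.1 ⟨2 * m + 1, by omega⟩
        refine ⟨⟨v, mt (h.2.2 v).2 (by simp [hv])⟩, ?_⟩
        ext
        simp only [hv]
        omega⟩)
  refine Nat.card_le_card_of_injective F ?_
  rintro ⟨h, hs, he⟩ ⟨g, gs, ge⟩ heq
  rw [Prod.ext_iff] at heq
  ext v
  have hp : Even (h v : ℕ) ↔ Even (g v : ℕ) := (he v).trans (ge v).symm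
  rw [Nat.even_iff, Nat.even_iff] at hp
  have : (h v : ℕ) / 2 = (g v : ℕ) / 2 := by
    by_cases hv : p v
    · exact congrArg Fin.val (congrFun (congrArg Subtype.val heq.1) ⟨v, hv⟩)
    · exact congrArg Fin.val (congrFun (congrArg Subtype.val heq.2) ⟨v, hv⟩)
  simp only
  omega

theorem le_card_parityLabelling {α : Type*} [Fintype α] (p : α → Prop) [DecidablePred p] (j : ℕ) :
    surjCount (Fintype.card {v // p v}) j * surjCount (Fintype.card {v // ¬ p v}) j ≤
      Nat.card (ParityLabelling p (2 * j)) := by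
  rw [← card_surjective_eq_surjCount, ← card_surjective_eq_surjCount, ← Nat.card_prod]
  let F : {f : {v // p v} → Fin j // Function.Surjective f} ×
      {f : {v // ¬ p v} → Fin j // Function.Surjective f} → ParityLabelling p (2 * j) := fun x =>
    ⟨fun v => if hv : p v then ⟨2 * (x.1.1 ⟨v, hv⟩ : ℕ), by omega⟩ else
      ⟨2 * (x.2.1 ⟨v, hv⟩ : ℕ) + 1, by omega⟩, fun m => by
        rcases Nat.even_or_odd' m with ⟨c, hc | hc⟩
        · obtain ⟨v, hv⟩ := x.1.2 ⟨c, by omega⟩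
          exact ⟨v, by simp [v.2, hv, Fin.ext_iff, hc]⟩
        · obtain ⟨v, hv⟩ := x.2.2 ⟨c, by omega⟩
          exact ⟨v, by simp [v.2, hv, Fin.ext_iff, hc]⟩, fun v => by
        by_cases hv : p v <;> simp [hv]⟩
  refine Nat.card_le_card_of_injective F ?_
  rintro ⟨⟨f, hf⟩, ⟨g, hg⟩⟩ ⟨⟨f', hf'⟩, ⟨g', hg'⟩⟩ heq
  simp only [F, Subtype.mk.injEq, funext_iff] at heq
  simp only [Prod.mk.injEq, Subtype.mk.injEq]
  constructor
  · ext v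
    simpa [v.2, Fin.ext_iff] using heq v
  · ext v
    simpa [v.2, Fin.ext_iff] using heq v

theorem IsThreshold.exists_parityLabelling {N k : ℕ} {π : Equiv.Perm (Fin (N + 1))}
    (hπ : IsThreshold k π) :
    ∃ τ : Bool, ∃ r : Fin (N + 2), ∃ h : ParityLabelling
      (fun v : Fin (N + 1) => decide ((v : ℕ) < k) = τ) r, StrictMono (blockKey k h.1 ∘ π) := by
  classical
  let c : Fin (N + 1) → ℕ := Fin.induction 0 fun i x =>
    if ((π i.castSucc : ℕ) < k ↔ (π i.succ : ℕ) < k) then x else x + 1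
  have hc0 : c 0 = 0 := rfl
  have hcs (i : Fin N) : c i.succ =
      if ((π i.castSucc : ℕ) < k ↔ (π i.succ : ℕ) < k) then c i.castSucc else c i.castSucc + 1 := by
    simp [c]
  have hmono : Monotone c := Fin.monotone_iff_le_succ.2 fun i => by
    rw [hcs]; split_ifs <;> omega
  have hle (i : Fin (N + 1)) : c i ≤ i := by
    induction i using Fin.induction with
    | zero => simp [hc0]
    | succ i ih =>
      rw [hcs]; simp at ih ⊢; split_ifs <;> omega
  have hsurj (i : Fin (N + 1)) : ∀ m ≤ c i, ∃ l, c l = m := by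
    induction i using Fin.induction with
    | zero => exact fun m hm => ⟨0, by omega⟩
    | succ i ih =>
      intro m hm
      rcases eq_or_lt_of_le hm with rfl | hm
      · exact ⟨_, rfl⟩
      · refine ih m ?_
        rw [hcs] at hm
        split_ifs at hm <;> omega
  have hpar (i : Fin (N + 1)) : Even (c i) ↔ ((π i : ℕ) < k ↔ (π 0 : ℕ) < k) := by
    induction i using Fin.induction with
    | zero => simp [hc0]
    | succ i ih =>
      rw [hcs]
      split_ifs with h
      · rw [ih, h]
      · rw [Nat.even_add_one, ih]
        tauto
  refine ⟨decide ((π 0 : ℕ) < k), ⟨c (Fin.last N) + 1, ?_⟩,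
    ⟨fun v => ⟨c (π.symm v), ?_⟩, ?_, ?_⟩, ?_⟩
  · have := hle (Fin.last N)
    simp at this
    omega
  · exact Nat.lt_succ_of_le (hmono (Fin.le_last _))
  · intro m
    obtain ⟨l, hl⟩ := hsurj (Fin.last N) m (Nat.le_of_lt_succ m.2)
    exact ⟨π l, Fin.ext (by simp [hl])⟩
  · intro v
    simp [hpar]
  · refine Fin.strictMono_iff_lt_succ.2 fun i => ?_
    simp only [blockKey, Function.comp_apply, Equiv.symm_apply_apply, Prod.Lex.toLex_lt_toLex]
    have h1 := (hπ i).1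
    have h2 := (hπ i).2
    rw [Fin.lt_def] at h1 h2
    rw [hcs]
    split_ifs <;> omega

theorem monotone_of_strictMono_blockKey {n k r : ℕ} {π : Equiv.Perm (Fin n)} {h : Fin n → Fin r}
    (hπ : StrictMono (blockKey k h ∘ π)) : Monotone (h ∘ π) := by
  intro i j hij
  have := hπ.monotone hij
  simp only [blockKey, Function.comp_apply, Prod.Lex.toLex_le_toLex] at this
  rw [Fin.le_def, Function.comp_apply, Function.comp_apply]
  omega

theorem label_succ_le {N r : ℕ} {π : Equiv.Perm (Fin (N + 1))} {h : Fin (N + 1) → Fin r}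
    (hs : Function.Surjective h) (hm : Monotone (h ∘ π)) (i : Fin N) :
    (h (π i.succ) : ℕ) ≤ h (π i.castSucc) + 1 := by
  by_contra! hlt
  obtain ⟨u, hu⟩ := hs ⟨h (π i.castSucc) + 1, by omega⟩
  obtain ⟨l, rfl⟩ := π.surjective u
  have h1 : i.castSucc < l := hm.reflect_lt (by
    rw [Fin.lt_def, Function.comp_apply, Function.comp_apply, hu]; simp)
  have h2 : l < i.succ := hm.reflect_lt (by
    rw [Fin.lt_def, Function.comp_apply, Function.comp_apply, hu]; exact hlt)
  rw [Fin.lt_def] at h1 h2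
  simp at h1 h2
  omega

theorem isThreshold_of_strictMono {N k r : ℕ} {π : Equiv.Perm (Fin (N + 1))}
    (h : ParityLabelling (fun v : Fin (N + 1) => (v : ℕ) < k) r)
    (hπ : StrictMono (blockKey k h.1 ∘ π)) : IsThreshold k π := by
  intro i
  have h1 := label_succ_le h.2.1 (monotone_of_strictMono_blockKey hπ) i
  have h2 := hπ (Fin.castSucc_lt_succ (i := i))
  have h3 := h.2.2 (π i.castSucc)
  have h4 := h.2.2 (π i.succ)
  simp only [blockKey, Function.comp_apply, Prod.Lex.toLex_lt_toLex] at h2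
  rw [Nat.even_iff] at h3 h4
  rw [Fin.lt_def, Fin.lt_def]
  split_ifs at h2 <;> omega

theorem parityLabelling_ext {N k r : ℕ} {π : Equiv.Perm (Fin (N + 1))}
    {h g : ParityLabelling (fun v : Fin (N + 1) => (v : ℕ) < k) r}
    (hh : StrictMono (blockKey k h.1 ∘ π)) (hg : StrictMono (blockKey k g.1 ∘ π)) : h = g := by
  have hm := monotone_of_strictMono_blockKey hh
  have gm := monotone_of_strictMono_blockKey hg
  have zero_of {f : Fin (N + 1) → Fin r} (fs : Function.Surjective f) (fm : Monotone (f ∘ π)) :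
      (f (π 0) : ℕ) = 0 := by
    obtain ⟨u, hu⟩ := fs ⟨0, by have := (f 0).2; omega⟩
    obtain ⟨l, rfl⟩ := π.surjective u
    have := Fin.le_def.1 (fm (Fin.zero_le l))
    rw [Function.comp_apply, Function.comp_apply, hu] at this
    exact Nat.le_zero.1 this
  have key (i : Fin (N + 1)) : (h.1 (π i) : ℕ) = g.1 (π i) := by
    induction i using Fin.induction with
    | zero => rw [zero_of h.2.1 hm, zero_of g.2.1 gm]
    | succ i ih =>
      have h1 := label_succ_le h.2.1 hm i
      have h2 := label_succ_le g.2.1 gm i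
      have h3 := Fin.le_def.1 (hm (Fin.castSucc_lt_succ (i := i)).le)
      have h4 := Fin.le_def.1 (gm (Fin.castSucc_lt_succ (i := i)).le)
      have h5 := (h.2.2 (π i.succ)).trans (g.2.2 (π i.succ)).symm
      simp only [Function.comp_apply] at h3 h4
      rw [Nat.even_iff, Nat.even_iff] at h5
      omega
  ext v
  simpa using key (π.symm v)

theorem blockKey_injective {n r : ℕ} (k : ℕ) (h : Fin n → Fin r)
    (hp : ∀ v w, h v = h w → ((v : ℕ) < k ↔ (w : ℕ) < k)) :
    Function.Injective (blockKey k h) := by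
  intro v w hvw
  simp only [blockKey, EmbeddingLike.apply_eq_iff_eq, Prod.mk.injEq] at hvw
  have := hp v w (Fin.ext hvw.1)
  have h2 := hvw.2
  ext
  split_ifs at h2 <;> omega

theorem card_parityLabelling_le_avoidCount (N k j : ℕ) :
    Nat.card (ParityLabelling (fun v : Fin (N + 1) => (v : ℕ) < k) (2 * j)) ≤
      avoidCount (N + 1) := by
  have sorted (h : ParityLabelling (fun v : Fin (N + 1) => (v : ℕ) < k) (2 * j)) :
      StrictMono (blockKey k h.1 ∘ Tuple.sort (blockKey k h.1)) := by
    refine (Tuple.monotone_sort _).strictMono_of_injective (Function.Injective.comp ?_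
      (Equiv.injective _))
    refine blockKey_injective k h.1 fun v w hvw => ?_
    exact (h.2.2 v).symm.trans (hvw ▸ h.2.2 w)
  have hk (π : Equiv.Perm (Fin (N + 1))) (hπ : IsThreshold k π) :
      ¬ Contains2134 π ∧ ¬ Contains3421 π := by
    rw [avoids_iff]
    intro i j hi hj
    by_contra! h
    have := hπ i
    have := hπ j
    rw [Fin.lt_def] at *
    rw [Fin.le_def] at h
    omega
  refine Nat.card_le_card_of_injective (fun h => ⟨Tuple.sort (blockKey k h.1),
    hk _ (isThreshold_of_strictMono h (sorted h))⟩) fun h g hhg => ?_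
  have heq : Tuple.sort (blockKey k h.1) = Tuple.sort (blockKey k g.1) := congrArg Subtype.val hhg
  exact parityLabelling_ext (sorted h) (heq ▸ sorted g)

theorem avoidCount_le (N M : ℕ)
    (hM : ∀ a b r, a + b = N + 1 → surjCount a ((r + 1) / 2) * surjCount b (r / 2) ≤ M) :
    avoidCount (N + 1) ≤ 2 * (N + 2) ^ 2 * M := by
  classical
  let I := Fin (N + 2) × Bool × Fin (N + 2)
  let L (x : I) := ParityLabelling
    (fun v : Fin (N + 1) => decide ((v : ℕ) < (x.1 : ℕ)) = x.2.1) x.2.2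
  have hex (π : {π : Equiv.Perm (Fin (N + 1)) // ¬ Contains2134 π ∧ ¬ Contains3421 π}) :
      ∃ y : Σ x : I, L x, StrictMono (blockKey (y.1.1 : ℕ) y.2.1 ∘ π.1) := by
    obtain ⟨k, hk, hπ⟩ := (avoids_iff_exists_isThreshold π.1).1 π.2
    obtain ⟨τ, r, h, hh⟩ := hπ.exists_parityLabelling
    exact ⟨⟨(⟨k, by omega⟩, τ, r), h⟩, hh⟩
  choose F hF using hex
  have hinj : Function.Injective F := fun π ρ h =>
    Subtype.ext (perm_eq_of_strictMono_comp (hF π) (h ▸ hF ρ))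
  have hL (x : I) : Nat.card (L x) ≤ M := by
    refine (card_parityLabelling_le _ _).trans (hM _ _ _ ?_)
    rw [Fintype.card_subtype_compl, Fintype.card_fin]
    have := Fintype.card_subtype_le
      (fun v : Fin (N + 1) => decide ((v : ℕ) < (x.1 : ℕ)) = x.2.1)
    rw [Fintype.card_fin] at this
    omega
  calc avoidCount (N + 1) ≤ Nat.card (Σ x : I, L x) := Nat.card_le_card_of_injective F hinj
    _ = ∑ x : I, Nat.card (L x) := Nat.card_sigma
    _ ≤ ∑ _x : I, M := sum_le_sum fun x _ => hL x
    _ = _ := by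
      simp only [sum_const, card_univ, I, Fintype.card_prod, Fintype.card_fin, Fintype.card_bool,
        smul_eq_mul]
      ring

theorem surjCount_mul_surjCount_le_avoidCount {a b : ℕ} (hab : 0 < a + b) (j : ℕ) :
    surjCount a j * surjCount b j ≤ avoidCount (a + b) := by
  obtain ⟨N, hN⟩ := Nat.exists_eq_add_of_lt hab
  rw [zero_add] at hN
  have h := (le_card_parityLabelling (fun v : Fin (N + 1) => (v : ℕ) < a) j).trans
    (card_parityLabelling_le_avoidCount N a j)
  have hc : Fintype.card {v : Fin (N + 1) // (v : ℕ) < a} = a := by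
    rw [Fintype.card_subtype, Fin.card_filter_val_lt]
    omega
  rw [Fintype.card_subtype_compl, hc, Fintype.card_fin, ← hN, Nat.add_sub_cancel_left] at h
  exact h

theorem exp_sub_one_mul_exp_sub_one_le {x y : ℝ} (hxy : x + y = 2 * Real.log 2) :
    (Real.exp x - 1) * (Real.exp y - 1) ≤ 1 := by
  have h : Real.exp x * Real.exp y = 4 := by
    rw [← Real.exp_add, hxy, two_mul, Real.exp_add, Real.exp_log (by norm_num)]
    norm_num
  nlinarith [sq_nonneg (Real.exp x - Real.exp y), Real.exp_pos x, Real.exp_pos y]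

theorem exp_le_four {x y : ℝ} (hy : 0 ≤ y) (hxy : x + y = 2 * Real.log 2) :
    Real.exp x ≤ 4 := by
  calc Real.exp x ≤ Real.exp (Real.log 2 + Real.log 2) := Real.exp_le_exp.2 (by linarith)
    _ = 4 := by rw [Real.exp_add, Real.exp_log (by norm_num)]; norm_num

theorem factorial_mul_exp_le (k : ℕ) :
    (k.factorial : ℝ) * Real.exp k ≤ ((k : ℝ) + 1) ^ (k + 1) := by
  induction k with
  | zero => simp
  | succ k ih =>
    have h : Real.exp 1 * ((k : ℝ) + 1) ^ (k + 2) ≤ ((k : ℝ) + 2) ^ (k + 2) := by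
      have h1 : Real.exp (-(1 / ((k : ℝ) + 2))) ≥ 1 - 1 / ((k : ℝ) + 2) := by
        linarith [Real.add_one_le_exp (-(1 / ((k : ℝ) + 2)))]
      have h2 : (1 - 1 / ((k : ℝ) + 2)) = ((k : ℝ) + 1) / (k + 2) := by field_simp; ring
      have h3 : (((k : ℝ) + 1) / (k + 2)) ^ (k + 2) ≤ Real.exp (-1) := by
        calc _ ≤ Real.exp (-(1 / ((k : ℝ) + 2))) ^ (k + 2) := by
              rw [← h2]; gcongr; rw [h2]; positivity
          _ = _ := by
              rw [← Real.exp_nat_mul]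
              push_cast
              congr 1
              field_simp
      rw [div_pow, div_le_iff₀ (by positivity), Real.exp_neg] at h3
      calc _ ≤ Real.exp 1 * ((Real.exp 1)⁻¹ * ((k : ℝ) + 2) ^ (k + 2)) := by gcongr
        _ = _ := by field_simp
    rw [Nat.factorial_succ]
    push_cast
    rw [Real.exp_add]
    calc _ = (k.factorial * Real.exp k) * (Real.exp 1 * ((k : ℝ) + 1)) := by ring
      _ ≤ ((k : ℝ) + 1) ^ (k + 1) * (Real.exp 1 * ((k : ℝ) + 1)) := by gcongr
      _ = Real.exp 1 * ((k : ℝ) + 1) ^ (k + 2) := by ring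
      _ ≤ _ := by
        refine h.trans_eq ?_
        ring

theorem surjCount_mul_surjCount_le (a b r : ℕ) :
    (surjCount a ((r + 1) / 2) : ℝ) * surjCount b (r / 2) ≤
      3 * Real.exp 2 * ((a : ℝ) + b + 1) ^ 2 * (a + b).factorial / (2 * Real.log 2) ^ (a + b) := by
  have hL : 0 < Real.log 2 := Real.log_pos (by norm_num)
  obtain ⟨x, hx⟩ : ∃ x : ℝ, x = 2 * Real.log 2 * ((a + 1) / (a + b + 2)) := ⟨_, rfl⟩
  obtain ⟨y, hy⟩ : ∃ y : ℝ, y = 2 * Real.log 2 * ((b + 1) / (a + b + 2)) := ⟨_, rfl⟩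
  have hx0 : 0 < x := by rw [hx]; positivity
  have hy0 : 0 < y := by rw [hy]; positivity
  have hxy : x + y = 2 * Real.log 2 := by rw [hx, hy]; field_simp; ring
  have hX : 0 ≤ Real.exp x - 1 := by linarith [Real.one_le_exp hx0.le]
  have hY : 0 ≤ Real.exp y - 1 := by linarith [Real.one_le_exp hy0.le]
  have hXY := exp_sub_one_mul_exp_sub_one_le hxy
  have hpow : (Real.exp x - 1) ^ ((r + 1) / 2) * (Real.exp y - 1) ^ (r / 2) ≤ 3 := by
    have h1 := pow_le_one₀ (mul_nonneg hX hY) hXY (n := r / 2)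
    rw [mul_pow] at h1
    rcases (by omega : (r + 1) / 2 = r / 2 ∨ (r + 1) / 2 = r / 2 + 1) with h | h
    · rw [h]; linarith
    · rw [h, pow_succ]
      nlinarith [exp_le_four hy0.le hxy]
  have hfac : (a.factorial : ℝ) * b.factorial / (x ^ a * y ^ b) ≤
      Real.exp 2 * ((a : ℝ) + b + 1) ^ 2 * (a + b).factorial / (2 * Real.log 2) ^ (a + b) := by
    have e1 := factorial_mul_exp_le a
    have e2 := factorial_mul_exp_le b
    have e3 := Real.pow_div_factorial_le_exp (x := (a : ℝ) + b + 2) (by positivity) (a + b)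
    rw [div_le_iff₀ (by positivity)] at e3
    have e4 : Real.exp ((a : ℝ) + b + 2) = Real.exp a * Real.exp b * Real.exp 2 := by
      rw [Real.exp_add, Real.exp_add]
    have hxp : x ^ a * y ^ b = (2 * Real.log 2) ^ (a + b) *
        (((a : ℝ) + 1) ^ a * ((b : ℝ) + 1) ^ b) / ((a : ℝ) + b + 2) ^ (a + b) := by
      rw [hx, hy, mul_pow _ (_ / _), mul_pow _ (_ / _), div_pow, div_pow, pow_add, pow_add]
      field_simp
    rw [e4] at e3
    rw [hxp, div_div_eq_mul_div, div_le_div_iff₀ (by positivity) (by positivity)]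
    have e5 : ((a : ℝ) + 1) * (b + 1) ≤ ((a : ℝ) + b + 1) ^ 2 := by
      have ha : (0 : ℝ) ≤ a := a.cast_nonneg
      have hb : (0 : ℝ) ≤ b := b.cast_nonneg
      nlinarith [mul_nonneg ha hb]
    calc _ ≤ (a.factorial : ℝ) * b.factorial *
            (Real.exp a * Real.exp b * Real.exp 2 * (a + b).factorial) *
            (2 * Real.log 2) ^ (a + b) := by gcongr
      _ = (a.factorial * Real.exp a) * (b.factorial * Real.exp b) *
            (Real.exp 2 * (a + b).factorial * (2 * Real.log 2) ^ (a + b)) := by ring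
      _ ≤ ((a : ℝ) + 1) ^ (a + 1) * ((b : ℝ) + 1) ^ (b + 1) *
            (Real.exp 2 * (a + b).factorial * (2 * Real.log 2) ^ (a + b)) := by gcongr
      _ = (((a : ℝ) + 1) * (b + 1)) * (Real.exp 2 * (a + b).factorial *
            ((2 * Real.log 2) ^ (a + b) * (((a : ℝ) + 1) ^ a * ((b : ℝ) + 1) ^ b))) := by ring
      _ ≤ ((a : ℝ) + b + 1) ^ 2 * (Real.exp 2 * (a + b).factorial *
            ((2 * Real.log 2) ^ (a + b) * (((a : ℝ) + 1) ^ a * ((b : ℝ) + 1) ^ b))) := by gcongr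
      _ = _ := by ring
  calc (surjCount a ((r + 1) / 2) : ℝ) * surjCount b (r / 2)
      = ((surjCount a ((r + 1) / 2) : ℝ) / a.factorial * x ^ a) *
          ((surjCount b (r / 2) : ℝ) / b.factorial * y ^ b) *
          ((a.factorial : ℝ) * b.factorial / (x ^ a * y ^ b)) := by
        have := a.factorial_ne_zero
        have := b.factorial_ne_zero
        field_simp
    _ ≤ (Real.exp x - 1) ^ ((r + 1) / 2) * (Real.exp y - 1) ^ (r / 2) *
          ((a.factorial : ℝ) * b.factorial / (x ^ a * y ^ b)) := by
        gcongr
        · exact surjCount_mul_pow_le hx0.le _ _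
        · exact surjCount_mul_pow_le hy0.le _ _
    _ ≤ 3 * (Real.exp 2 * ((a : ℝ) + b + 1) ^ 2 * (a + b).factorial /
          (2 * Real.log 2) ^ (a + b)) := by gcongr
    _ = _ := by ring

theorem avoidCount_div_factorial_le {n : ℕ} (hn : 1 ≤ n) :
    (avoidCount n : ℝ) / n.factorial ≤
      6 * Real.exp 2 * ((n : ℝ) + 1) ^ 4 * (1 / (2 * Real.log 2)) ^ n := by
  have hL : 0 < Real.log 2 := Real.log_pos (by norm_num)
  obtain ⟨N, rfl⟩ : ∃ N, n = N + 1 := ⟨n - 1, by omega⟩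
  obtain ⟨B, hB⟩ : ∃ B : ℝ, B = 3 * Real.exp 2 * (((N + 1 : ℕ) : ℝ) + 1) ^ 2 *
    (N + 1).factorial / (2 * Real.log 2) ^ (N + 1) := ⟨_, rfl⟩
  have hB0 : 0 ≤ B := by rw [hB]; positivity
  have h := avoidCount_le N ⌊B⌋₊ fun a b r hab => Nat.le_floor (by
    rw [hB, ← hab]
    push_cast
    exact surjCount_mul_surjCount_le a b r)
  rw [div_le_iff₀ (by positivity)]
  calc (avoidCount (N + 1) : ℝ) ≤ ((2 * (N + 2) ^ 2 * ⌊B⌋₊ : ℕ) : ℝ) := by exact_mod_cast h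
    _ = 2 * ((N : ℝ) + 2) ^ 2 * ⌊B⌋₊ := by push_cast; ring
    _ ≤ 2 * ((N : ℝ) + 2) ^ 2 * B := by gcongr; exact Nat.floor_le hB0
    _ = _ := by
      rw [hB]
      push_cast
      rw [one_div, inv_pow]
      ring

theorem le_avoidCount_div_factorial {n : ℕ} (hn : 2 ≤ n) :
    1 / ((n : ℝ) + 1) ^ 5 * (1 / (2 * Real.log 2)) ^ n ≤ (avoidCount n : ℝ) / n.factorial := by
  have hL : 0 < Real.log 2 := Real.log_pos (by norm_num)
  have hL2 : 1 ≤ 2 * Real.log 2 := by linarith [Real.log_two_gt_d9]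
  obtain ⟨a, ha, ha'⟩ : ∃ a, 1 ≤ a ∧ (n = a + a ∨ n = a + (a + 1)) := ⟨n / 2, by omega, by omega⟩
  obtain ⟨j, hj⟩ := exists_le_surjCount a
  have hj0 : j ≠ 0 := by
    rintro rfl
    rw [surjCount_zero_right ha, Nat.cast_zero] at hj
    exact absurd hj (not_le.2 (by positivity))
  obtain ⟨j, rfl⟩ := Nat.exists_eq_succ_of_ne_zero hj0
  have hcount : surjCount a (j + 1) * surjCount a (j + 1) ≤ avoidCount n := by
    rcases ha' with rfl | rfl
    · exact surjCount_mul_surjCount_le_avoidCount (by omega) _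
    · exact (Nat.mul_le_mul_left _ (surjCount_le_surjCount_succ a j)).trans
        (surjCount_mul_surjCount_le_avoidCount (by omega) _)
  have hcount' : (surjCount a (j + 1) : ℝ) * surjCount a (j + 1) ≤ avoidCount n := by
    exact_mod_cast hcount
  have hfac : (n.factorial : ℝ) ≤ ((n : ℝ) + 1) * (4 ^ a * (a.factorial * a.factorial)) := by
    have h2 : (a + a).factorial ≤ 4 ^ a * (a.factorial * a.factorial) := by
      rw [← Nat.add_choose_mul_factorial_mul_factorial a a, mul_assoc]
      refine Nat.mul_le_mul_right _ ((Nat.choose_le_two_pow _ _).trans_eq ?_)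
      rw [← two_mul, pow_mul]
      norm_num
    have h3 : n.factorial ≤ (n + 1) * (a + a).factorial := by
      rcases ha' with rfl | rfl
      · exact Nat.le_mul_of_pos_left _ (by omega)
      · rw [← add_assoc, Nat.factorial_succ]
        exact Nat.mul_le_mul_right _ (by omega)
    exact_mod_cast h3.trans (Nat.mul_le_mul_left _ h2)
  rw [le_div_iff₀ (by positivity)]
  have hpow : (1 / (2 * Real.log 2)) ^ n ≤ (1 / (2 * Real.log 2)) ^ (a + a) :=
    pow_le_pow_of_le_one (by positivity) ((div_le_one (by positivity)).2 hL2) (by omega)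
  have han : (a : ℝ) + 1 ≤ n + 1 := by
    have : a ≤ n := by omega
    gcongr
  calc _ ≤ 1 / ((n : ℝ) + 1) ^ 5 * (1 / (2 * Real.log 2)) ^ (a + a) *
        (((n : ℝ) + 1) * (4 ^ a * (a.factorial * a.factorial))) := by gcongr
    _ = 1 / ((n : ℝ) + 1) ^ 4 * ((a.factorial * a.factorial) / Real.log 2 ^ (a + a)) := by
      rw [div_pow, mul_pow, one_pow, show (2 : ℝ) ^ (a + a) = 4 ^ a by
        rw [← two_mul, pow_mul]; norm_num]
      field_simp
    _ ≤ 1 / ((a : ℝ) + 1) ^ 4 * ((a.factorial * a.factorial) / Real.log 2 ^ (a + a)) := by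
      gcongr
    _ = (a.factorial : ℝ) / (((a : ℝ) + 1) ^ 2 * Real.log 2 ^ a) *
        (a.factorial / (((a : ℝ) + 1) ^ 2 * Real.log 2 ^ a)) := by
      rw [pow_add]
      field_simp
    _ ≤ (surjCount a (j + 1) : ℝ) * surjCount a (j + 1) := by gcongr
    _ ≤ _ := hcount'

theorem tendsto_const_mul_pow_mul_pow_rpow_inv {C x : ℝ} (hC : 0 < C) (hx : 0 ≤ x) (d : ℝ) :
    Filter.Tendsto (fun n : ℕ => (C * ((n : ℝ) + 1) ^ d * x ^ n) ^ ((n : ℝ)⁻¹))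
      Filter.atTop (nhds x) := by
  have hinv : Filter.Tendsto (fun n : ℕ => ((n : ℝ))⁻¹) Filter.atTop (nhds 0) :=
    tendsto_inv_atTop_nhds_zero_nat
  have h1 : Filter.Tendsto (fun n : ℕ => C ^ ((n : ℝ)⁻¹)) Filter.atTop (nhds 1) := by
    have := (Real.continuousAt_const_rpow (b := 0) hC.ne').tendsto.comp hinv
    rwa [Real.rpow_zero] at this
  have h2 : Filter.Tendsto (fun n : ℕ => ((n : ℝ) + 1) ^ (d / (1 * ((n : ℝ) + 1) + -1)))
      Filter.atTop (nhds 1) :=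
    (tendsto_rpow_div_mul_add d 1 (-1) one_ne_zero.symm).comp
      (Filter.tendsto_atTop_add_const_right _ 1 tendsto_natCast_atTop_atTop)
  have h3 := (h1.mul h2).mul_const x
  rw [one_mul, one_mul] at h3
  refine h3.congr' ?_
  filter_upwards [Filter.eventually_ge_atTop 1] with n hn
  have hn' : n ≠ 0 := by omega
  rw [Real.mul_rpow (by positivity) (by positivity), Real.mul_rpow (by positivity) (by positivity),
    Real.pow_rpow_inv_natCast hx hn', ← Real.rpow_mul (by positivity)]
  congr 3
  rw [one_mul, add_neg_cancel_right, div_eq_mul_inv]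

theorem stmt2 :
    Filter.Tendsto
      (fun n : ℕ => ((avoidCount n : ℝ) / (Nat.factorial n : ℝ)) ^ ((n : ℝ)⁻¹))
      Filter.atTop (nhds (1 / (2 * Real.log 2))) := by
  have hL : 0 < Real.log 2 := Real.log_pos (by norm_num)
  refine tendsto_of_tendsto_of_tendsto_of_le_of_le'
    (tendsto_const_mul_pow_mul_pow_rpow_inv one_pos (by positivity) (-5))
    (tendsto_const_mul_pow_mul_pow_rpow_inv (C := 6 * Real.exp 2) (by positivity)
      (by positivity) 4) ?_ ?_
  · filter_upwards [Filter.eventually_ge_atTop 2] with n hn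
    refine Real.rpow_le_rpow (by positivity)
      (le_trans (le_of_eq ?_) (le_avoidCount_div_factorial hn)) (by positivity)
    rw [Real.rpow_neg (by positivity), one_mul, one_div (((n : ℝ) + 1) ^ 5)]
    norm_cast
  · filter_upwards [Filter.eventually_ge_atTop 1] with n hn
    refine Real.rpow_le_rpow (by positivity)
      ((avoidCount_div_factorial_le hn).trans (le_of_eq ?_)) (by positivity)
    norm_cast
end

section
/- For every positive integer n, |C*_{n+1}| = Σ_{k=0}^{n−1} [b^k a^{n−1−k}]. -/
/-- `π` has a stretching pair: 1-indexed positions `1 ≤ i < j ≤ n` (here 0-indexed) with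
`π(i) < i < j < π(j)`. -/
def HasStretchingPair {n : ℕ} (π : Equiv.Perm (Fin n)) : Prop :=
  ∃ i j : Fin n, π i < i ∧ i < j ∧ j < π j

/-- `|C*_m|`: the number of `m`-cycles in `S_m` with no stretching pair. -/
noncomputable def cStarCard (m : ℕ) : ℕ :=
  Nat.card {π : Equiv.Perm (Fin m) //
    π.IsCycle ∧ π.support.card = m ∧ ¬ HasStretchingPair π}

/-- `[b^r a^s]` where `r + s = n - 1`: the number of permutations `π ∈ S_n` (on `Fin n`,
position `i : Fin n` representing the 1-indexed position `i + 1`) such that for every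
`i ∈ {1, …, n-1}`, `π(i) > i` if and only if `i ≤ r`. -/
noncomputable def excWordCount (n r : ℕ) : ℕ :=
  Nat.card {π : Equiv.Perm (Fin n) //
    ∀ i : Fin n, (i : ℕ) + 1 ≤ n - 1 → ((i : ℕ) + 1 ≤ r ↔ i < π i)}

open Equiv Equiv.Perm

/-- A permutation is transitive if it has a single orbit. -/
def PermTransitive {α : Type*} (σ : Perm α) : Prop := ∀ x y, SameCycle σ x y

theorem SameCycle.rel_of_step {α : Type*} {σ : Perm α} (r : Setoid α)
    (h : ∀ x, r x (σ x)) {x y : α} (hxy : SameCycle σ x y) : r x y := by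
  obtain ⟨k, rfl⟩ := hxy
  induction k with
  | zero => exact r.refl _
  | succ k ih =>
    rw [add_comm, zpow_add, zpow_one, Perm.mul_apply]
    exact r.trans ih (h _)
  | pred k ih =>
    refine r.trans ih (r.symm ?_)
    have := h ((σ ^ (-(k : ℤ) - 1)) x)
    rwa [← Perm.mul_apply, ← zpow_one_add, show (1 + (-(k : ℤ) - 1)) = -k by ring] at this

/-- Insert a new point `none` into `τ`, right after `k` in its cycle if `k` is an old point,
and as a fixed point if `k = none`. -/
def insertAfter {α : Type*} [DecidableEq α] : Option α × Perm α ≃ Perm (Option α) :=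
  ((Equiv.refl _).prodCongr (Equiv.inv _)).trans (decomposeOption.symm.trans (Equiv.inv _))

section insertAfter

variable {α : Type*} [DecidableEq α] (τ : Perm α)

theorem insertAfter_apply (k : Option α) :
    insertAfter (k, τ) = optionCongr τ * swap none k := by
  ext1 x
  simp only [insertAfter, Equiv.trans_apply, Equiv.prodCongr_apply, Prod.map,
    Equiv.refl_apply, Equiv.inv_apply, decomposeOption_symm_apply, mul_inv_rev, swap_inv]
  rfl

theorem insertAfter_some_self (x : α) : insertAfter (some x, τ) (some x) = none := by
  simp [insertAfter_apply]

theorem insertAfter_some_none (x : α) : insertAfter (some x, τ) none = some (τ x) := by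
  simp [insertAfter_apply]

theorem insertAfter_none_none : insertAfter (none, τ) none = none := by
  simp [insertAfter_apply]

theorem insertAfter_some_of_ne {k : Option α} {a : α} (h : k ≠ some a) :
    insertAfter (k, τ) (some a) = some (τ a) := by
  rw [insertAfter_apply, Perm.mul_apply, swap_apply_of_ne_of_ne (by simp) h.symm]
  simp

theorem permTransitive_insertAfter_some (x : α) :
    PermTransitive (insertAfter (some x, τ)) ↔ PermTransitive τ := by
  constructor
  · intro h a b
    have := SameCycle.rel_of_step ((SameCycle.setoid τ).comap fun u : Option α ↦ u.getD x)
      (fun u ↦ ?_) (h (some a) (some b))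
    · exact this
    · change SameCycle τ _ _
      rcases u with _ | a
      · rw [insertAfter_some_none]
        exact (SameCycle.refl τ x).apply_right
      · rcases eq_or_ne a x with rfl | hne
        · rw [insertAfter_some_self]
          exact SameCycle.refl _ _
        · rw [insertAfter_some_of_ne τ (by simpa using hne.symm)]
          exact (SameCycle.refl τ a).apply_right
  · intro h
    set σ := insertAfter (some x, τ) with hσ
    have key : ∀ a b, SameCycle σ (some a) (some b) := fun a b ↦ by
      refine SameCycle.rel_of_step ((SameCycle.setoid σ).comap some) (fun a ↦ ?_) (h a b)
      change SameCycle σ _ _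
      rcases eq_or_ne a x with rfl | hne
      · rw [← insertAfter_some_none τ a, ← insertAfter_some_self τ a, ← hσ]
        exact (SameCycle.refl σ _).apply_right.apply_right
      · rw [← insertAfter_some_of_ne τ (show some x ≠ some a by simpa using hne.symm), ← hσ]
        exact (SameCycle.refl σ _).apply_right
    have none_x : SameCycle σ none (some x) := by
      rw [← insertAfter_some_self τ x, ← hσ]
      exact (SameCycle.refl σ _).apply_left
    rintro (_ | a) (_ | b)
    · exact SameCycle.refl _ _
    · exact none_x.trans (key _ _)
    · exact (key _ _).trans none_x.symm
    · exact key _ _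

theorem not_permTransitive_insertAfter_none [Nonempty α] :
    ¬ PermTransitive (insertAfter (none, τ)) := fun h ↦ by
  have := (h none (some (Classical.arbitrary α))).eq_of_left (insertAfter_none_none τ)
  simp at this

end insertAfter

theorem permTransitive_permCongr {α β : Type*} (e : α ≃ β) (σ : Perm α) :
    PermTransitive (e.permCongr σ) ↔ PermTransitive σ := by
  constructor
  · intro h a b
    have := SameCycle.rel_of_step ((SameCycle.setoid σ).comap e.symm) (fun u ↦ ?_)
      (h (e a) (e b))
    · change SameCycle _ _ _ at this
      simpa using this
    · change SameCycle _ _ _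
      simpa using (SameCycle.refl σ (e.symm u)).apply_right
  · intro h a b
    have := SameCycle.rel_of_step ((SameCycle.setoid (e.permCongr σ)).comap e) (fun u ↦ ?_)
      (h (e.symm a) (e.symm b))
    · change SameCycle _ _ _ at this
      simpa using this
    · change SameCycle _ _ _
      have := (SameCycle.refl (e.permCongr σ) (e u)).apply_right
      simpa using this

/-- Insert a new largest point into a permutation of `Fin n`. -/
def insertLast (n : ℕ) : Option (Fin n) × Perm (Fin n) ≃ Perm (Fin (n + 1)) :=
  insertAfter.trans finSuccEquivLast.symm.permCongr

theorem not_last_lt {n : ℕ} (σ : Perm (Fin (n + 1))) : ¬ Fin.last n < σ (Fin.last n) :=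
  not_lt.2 (Fin.le_last _)

theorem castSucc_lt_insertLast {n : ℕ} (k : Option (Fin n)) (τ : Perm (Fin n)) (j : Fin n) :
    j.castSucc < insertLast n (k, τ) j.castSucc ↔ j < τ j ∨ k = some j := by
  simp only [insertLast, Equiv.trans_apply, permCongr_apply, Equiv.symm_symm,
    finSuccEquivLast_castSucc]
  by_cases hk : k = some j
  · subst hk
    simp [insertAfter_some_self, Fin.castSucc_lt_last]
  · simp [insertAfter_some_of_ne τ hk, hk]

/-- Insertion of a largest point after a given point, as a bijection on transitive
permutations. -/
noncomputable def insertLastTransitive (n : ℕ) :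
    Fin (n + 1) × {c : Perm (Fin (n + 1)) // PermTransitive c} ≃
      {c : Perm (Fin (n + 2)) // PermTransitive c} :=
  Equiv.ofBijective (fun p ↦ ⟨insertLast (n + 1) (some p.1, p.2.1),
    (permTransitive_permCongr _ _).2 ((permTransitive_insertAfter_some _ _).2 p.2.2)⟩) <| by
    constructor
    · rintro ⟨x, τ, hτ⟩ ⟨y, τ', hτ'⟩ h
      have := (insertLast (n + 1)).injective (congrArg Subtype.val h)
      simp_all
    · rintro ⟨c, hc⟩
      obtain ⟨⟨k, τ⟩, rfl⟩ := (insertLast (n + 1)).surjective c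
      have h := (permTransitive_permCongr _ _).1 hc
      rcases k with _ | x
      · exact absurd h (not_permTransitive_insertAfter_none τ)
      · exact ⟨⟨x, τ, (permTransitive_insertAfter_some τ x).1 h⟩, rfl⟩

theorem exists_equiv_transitive (n : ℕ) :
    ∃ e : Perm (Fin n) ≃ {c : Perm (Fin (n + 1)) // PermTransitive c},
      ∀ π i, i.succ < (e π).1 i.succ ↔ i < π i := by
  induction n with
  | zero =>
    have : Unique {c : Perm (Fin 1) // PermTransitive c} :=
      ⟨⟨1, fun x y ↦ Subsingleton.elim x y ▸ SameCycle.refl _ _⟩,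
        fun c ↦ Subsingleton.elim _ _⟩
    exact ⟨Equiv.ofUnique _ _, fun _ i ↦ i.elim0⟩
  | succ n ih =>
    obtain ⟨e, he⟩ := ih
    refine ⟨(insertLast n).symm.trans
      (((finSuccEquiv n).symm.prodCongr e).trans (insertLastTransitive n)), fun π i ↦ ?_⟩
    obtain ⟨⟨k, τ⟩, rfl⟩ := (insertLast n).surjective π
    obtain ⟨k, rfl⟩ := (finSuccEquiv n).surjective k
    induction i using Fin.lastCases with
    | last =>
      rw [Fin.succ_last]
      exact iff_of_false (not_last_lt _) (not_last_lt _)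
    | cast j =>
      rw [Fin.succ_castSucc, castSucc_lt_insertLast]
      simp only [Equiv.trans_apply, Equiv.symm_apply_apply, Equiv.prodCongr_apply, Prod.map]
      change j.succ.castSucc < insertLast (n + 1) (some k, (e τ).1) j.succ.castSucc ↔ _
      rw [castSucc_lt_insertLast, he, Option.some_inj, ← finSuccEquiv_succ,
        (finSuccEquiv n).injective.eq_iff]

theorem isCycle_and_card_support_iff {n : ℕ} (hn : 0 < n) (c : Perm (Fin (n + 1))) :
    c.IsCycle ∧ c.support.card = n + 1 ↔ PermTransitive c := by
  have hs : c.support.card = n + 1 ↔ ∀ x, c x ≠ x := by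
    have h := Finset.card_eq_iff_eq_univ c.support
    rw [Fintype.card_fin, Finset.eq_univ_iff_forall] at h
    simpa using h
  rw [hs]
  constructor
  · rintro ⟨h, h'⟩ x y
    exact h.sameCycle (h' x) (h' y)
  · intro h
    have hne : ∀ x, c x ≠ x := fun x hx ↦ by
      have : Nontrivial (Fin (n + 1)) := Fin.nontrivial_iff_two_le.2 (by omega)
      obtain ⟨y, hy⟩ := exists_ne x
      exact hy ((h x y).eq_of_left hx).symm
    exact ⟨⟨0, hne 0, fun y _ ↦ h 0 y⟩, hne⟩

theorem not_hasStretchingPair_iff {n : ℕ} (c : Perm (Fin (n + 1))) (hc : ∀ x, c x ≠ x) :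
    ¬ HasStretchingPair c ↔
      ∀ i j : Fin n, i < j → j.succ < c j.succ → i.succ < c i.succ := by
  constructor
  · intro h i j hij hj
    by_contra hi
    exact h ⟨i.succ, j.succ, lt_of_le_of_ne (not_lt.1 hi) (hc _), by simpa, hj⟩
  · rintro h ⟨i, j, hi, hij, hj⟩
    obtain ⟨i, rfl⟩ := Fin.exists_succ_eq.2 (Fin.ne_zero_of_lt hi)
    obtain ⟨j, rfl⟩ := Fin.exists_succ_eq.2 (Fin.ne_zero_of_lt hij)
    exact lt_asymm hi (h i j (by simpa using hij) hj)

theorem excedances_initial_iff {n : ℕ} (hn : 0 < n) (π : Perm (Fin n)) :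
    (∀ i j, i < j → j < π j → i < π i) ↔ ∃ k : Fin n,
      ∀ i : Fin n, (i : ℕ) + 1 ≤ n - 1 → ((i : ℕ) + 1 ≤ k ↔ i < π i) := by
  constructor
  · intro h
    let l : Fin n := ⟨n - 1, by omega⟩
    have hl : ¬ l < π l := by
      rw [not_lt, Fin.le_def]
      have := (π l).isLt
      simp only [l] at *
      omega
    obtain ⟨k, hk, hmin⟩ := exists_minimal_of_wellFoundedLT (fun k ↦ ¬ k < π k) ⟨l, hl⟩
    refine ⟨k, fun i _ ↦ ⟨fun hik ↦ ?_, fun hi ↦ ?_⟩⟩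
    · by_contra hi
      have : k ≤ i := hmin hi (Fin.le_def.2 (by omega))
      rw [Fin.le_def] at this
      omega
    · by_contra hik
      rcases (show k ≤ i from Fin.le_def.2 (by omega)).eq_or_lt with rfl | hlt
      · exact hk hi
      · exact hk (h k i hlt hi)
  · rintro ⟨k, hk⟩ i j hij hj
    have h1 := hk j
    have h2 := hk i
    have := (π j).isLt
    rw [Fin.lt_def] at *
    grind

theorem stmt5 (n : ℕ) (hn : 0 < n) :
    cStarCard (n + 1) = ∑ k ∈ Finset.range n, excWordCount n k := by
  obtain ⟨e, he⟩ := exists_equiv_transitive n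
  have key (π : Perm (Fin n)) : ¬ HasStretchingPair (e π).1 ↔ ∃ k : Fin n,
      ∀ i : Fin n, (i : ℕ) + 1 ≤ n - 1 → ((i : ℕ) + 1 ≤ k ↔ i < π i) := by
    have h := (isCycle_and_card_support_iff hn _).2 (e π).2
    have hfix : ∀ x, (e π).1 x ≠ x := fun x ↦ by
      rw [← mem_support, Finset.eq_univ_of_card _ (h.2.trans (Fintype.card_fin _).symm)]
      exact Finset.mem_univ x
    rw [not_hasStretchingPair_iff _ hfix, ← excedances_initial_iff hn]
    simp only [he]
  have hcard : cStarCard (n + 1) = Nat.card {π : Perm (Fin n) // ∃ k : Fin n,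
      ∀ i : Fin n, (i : ℕ) + 1 ≤ n - 1 → ((i : ℕ) + 1 ≤ k ↔ i < π i)} := by
    refine Nat.card_congr (Equiv.trans (Equiv.trans (Equiv.subtypeEquivRight fun c ↦ ?_)
      (Equiv.subtypeSubtypeEquivSubtypeInter PermTransitive
        fun c ↦ ¬ HasStretchingPair c).symm) (e.subtypeEquiv fun π ↦ (key π).symm).symm)
    rw [← and_assoc, isCycle_and_card_support_iff hn]
  rw [hcard, Finset.sum_range]
  simp only [excWordCount]
  rw [← Nat.card_sigma]
  refine Nat.card_congr (Equiv.ofBijective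
    (fun p ↦ ⟨p.2.1, p.1, p.2.2⟩) ⟨?_, fun ⟨π, k, hk⟩ ↦ ⟨⟨k, π, hk⟩, rfl⟩⟩).symm
  rintro ⟨k, π, hk⟩ ⟨l, π', hl⟩ h
  obtain rfl : π = π' := congrArg Subtype.val h
  obtain rfl : k = l := by
    have hk1 := hk k
    have hk2 := hl k
    have hl1 := hk l
    have hl2 := hl l
    ext
    grind
  rfl
end

section
/- For every positive integer n, |C*_{n+1}| ≤ α_n({21-34, 34-21}) ≤ |C*_{n+1}| + |C*_{n+2}| ≤ 2·|C*_{n+2}|. -/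
/-- The permutation of `Fin (n + 1)` that sends the position `q` to the value `p` and arranges the
remaining values at the remaining positions in the same relative order as `σ`. -/
def insertAt {n : ℕ} (q p : Fin (n + 1)) (σ : Equiv.Perm (Fin n)) : Equiv.Perm (Fin (n + 1)) :=
  (finSuccEquiv' q).trans ((Equiv.optionCongr σ).trans (finSuccEquiv' p).symm)

/-- The cycle of length `n + 1` whose cycle notation is the word of `σ` (avoiding the value `p`)
followed by `p`. -/
def cycleOfWord {n : ℕ} (p : Fin (n + 1)) (σ : Equiv.Perm (Fin n)) : Equiv.Perm (Fin (n + 1)) :=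
  insertAt (Fin.last n) p σ * finRotate (n + 1) * (insertAt (Fin.last n) p σ)⁻¹

/-- The word of `σ` has adjacent entries `b a` and `c d` with `a < b < c < d`, in either order. -/
def HasStretchingWord {m : ℕ} (σ : Equiv.Perm (Fin (m + 1))) : Prop :=
  ∃ i j : Fin m, σ i.succ < σ i.castSucc ∧ σ i.castSucc < σ j.castSucc ∧
    σ j.castSucc < σ j.succ

lemma insertAt_self {n : ℕ} (q p : Fin (n + 1)) (σ : Equiv.Perm (Fin n)) :
    insertAt q p σ q = p := by
  simp [insertAt]

lemma insertAt_succAbove {n : ℕ} (q p : Fin (n + 1)) (σ : Equiv.Perm (Fin n)) (k : Fin n) :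
    insertAt q p σ (q.succAbove k) = p.succAbove (σ k) := by
  simp [insertAt]

lemma insertAt_last_castSucc {n : ℕ} (p : Fin (n + 1)) (σ : Equiv.Perm (Fin n)) (k : Fin n) :
    insertAt (Fin.last n) p σ k.castSucc = p.succAbove (σ k) := by
  simpa using insertAt_succAbove (Fin.last n) p σ k

lemma insertAt_zero_succ {n : ℕ} (p : Fin (n + 1)) (σ : Equiv.Perm (Fin n)) (k : Fin n) :
    insertAt 0 p σ k.succ = p.succAbove (σ k) := by
  simpa using insertAt_succAbove 0 p σ k

lemma insertAt_injective {n : ℕ} (q p : Fin (n + 1)) : Function.Injective (insertAt q p) := by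
  intro σ τ h
  ext k
  have hk := congrArg (fun f => f (q.succAbove k)) h
  simp only [insertAt_succAbove] at hk
  rw [Fin.succAbove_right_injective hk]

lemma exists_insertAt_eq {n : ℕ} {q p : Fin (n + 1)} {g : Equiv.Perm (Fin (n + 1))}
    (hg : g q = p) : ∃ σ, insertAt q p σ = g := by
  refine ⟨Equiv.removeNone ((finSuccEquiv' q).symm.trans (g.trans (finSuccEquiv' p))), ?_⟩
  set e := (finSuccEquiv' q).symm.trans (g.trans (finSuccEquiv' p)) with he
  have hnone : e none = none := by simp [he, hg]
  have hcongr : Equiv.optionCongr (Equiv.removeNone e) = e := by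
    refine Equiv.ext fun x => ?_
    cases x with
    | none => simp [hnone]
    | some x =>
      refine Equiv.removeNone_some e (Option.ne_none_iff_exists'.1 fun h => ?_)
      exact absurd (e.injective (h.trans hnone.symm)) (by simp)
  rw [insertAt, hcongr, he]
  ext
  simp

lemma cycleOfWord_apply {n : ℕ} (p : Fin (n + 1)) (σ : Equiv.Perm (Fin n)) (k : Fin (n + 1)) :
    cycleOfWord p σ (insertAt (Fin.last n) p σ k) = insertAt (Fin.last n) p σ (k + 1) := by
  simp [cycleOfWord]

lemma cycleOfWord_injective {n : ℕ} (p : Fin (n + 1)) : Function.Injective (cycleOfWord p) := by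
  intro σ τ h
  have key : ∀ k : Fin (n + 1),
      insertAt (Fin.last n) p σ k = insertAt (Fin.last n) p τ k →
      insertAt (Fin.last n) p σ (k + 1) = insertAt (Fin.last n) p τ (k + 1) := by
    intro k hk
    rw [← cycleOfWord_apply, ← cycleOfWord_apply, hk, h]
  apply insertAt_injective (Fin.last n) p
  ext k
  congr 1
  induction k using Fin.induction with
  | zero => simpa using key (Fin.last n) (by simp [insertAt_self])
  | succ k ih => simpa using key k.castSucc ih

lemma cycleOfWord_isCycle {m : ℕ} (p : Fin (m + 2)) (σ : Equiv.Perm (Fin (m + 1))) :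
    (cycleOfWord p σ).IsCycle :=
  isCycle_finRotate.conj

lemma card_support_cycleOfWord {m : ℕ} (p : Fin (m + 2)) (σ : Equiv.Perm (Fin (m + 1))) :
    (cycleOfWord p σ).support.card = m + 2 := by
  rw [cycleOfWord, Equiv.Perm.card_support_conj, support_finRotate, Finset.card_univ,
    Fintype.card_fin]

lemma exists_cycleOfWord_eq {m : ℕ} (p : Fin (m + 2)) {π : Equiv.Perm (Fin (m + 2))}
    (hπ : π.IsCycle) (hc : π.support.card = m + 2) : ∃ σ, cycleOfWord p σ = π := by
  obtain ⟨g, hg⟩ := isConj_iff.1 ((isCycle_finRotate (n := m)).isConj hπ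
    (by rw [hc, support_finRotate, Finset.card_univ, Fintype.card_fin]))
  obtain ⟨σ, hσ⟩ := exists_insertAt_eq (q := Fin.last (m + 1)) (p := p)
    (g := (Equiv.addRight (g⁻¹ p - Fin.last (m + 1))).trans g) (by simp)
  refine ⟨σ, Equiv.ext fun x => ?_⟩
  obtain ⟨k, rfl⟩ := (insertAt (Fin.last (m + 1)) p σ).surjective x
  rw [cycleOfWord_apply, hσ, ← hg]
  simp only [Equiv.trans_apply, Equiv.coe_addRight, Equiv.Perm.mul_apply,
    Equiv.Perm.coe_inv, Equiv.symm_apply_apply, finRotate_apply]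
  congr 1
  abel

lemma hasStretchingPair_cycleOfWord {n : ℕ} (p : Fin (n + 1)) (σ : Equiv.Perm (Fin n)) :
    HasStretchingPair (cycleOfWord p σ) ↔ ∃ a b : Fin (n + 1),
      insertAt (Fin.last n) p σ (a + 1) < insertAt (Fin.last n) p σ a ∧
      insertAt (Fin.last n) p σ a < insertAt (Fin.last n) p σ b ∧
      insertAt (Fin.last n) p σ b < insertAt (Fin.last n) p σ (b + 1) := by
  simp only [HasStretchingPair, ← cycleOfWord_apply]
  constructor
  · rintro ⟨i, j, h⟩
    obtain ⟨a, rfl⟩ := (insertAt (Fin.last n) p σ).surjective i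
    obtain ⟨b, rfl⟩ := (insertAt (Fin.last n) p σ).surjective j
    exact ⟨a, b, h⟩
  · rintro ⟨a, b, h⟩
    exact ⟨_, _, h⟩

lemma insertAt_last_castSucc_castSucc_add_one {m : ℕ} (p : Fin (m + 2))
    (σ : Equiv.Perm (Fin (m + 1))) (i : Fin m) :
    insertAt (Fin.last (m + 1)) p σ (i.castSucc.castSucc + 1) = p.succAbove (σ i.succ) := by
  rw [Fin.coeSucc_eq_succ, Fin.succ_castSucc, insertAt_last_castSucc]

lemma HasStretchingWord.hasStretchingPair {m : ℕ} {σ : Equiv.Perm (Fin (m + 1))}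
    (h : HasStretchingWord σ) (p : Fin (m + 2)) : HasStretchingPair (cycleOfWord p σ) := by
  obtain ⟨i, j, h⟩ := h
  rw [hasStretchingPair_cycleOfWord]
  refine ⟨i.castSucc.castSucc, j.castSucc.castSucc, ?_⟩
  simpa only [insertAt_last_castSucc_castSucc_add_one, insertAt_last_castSucc,
    Fin.succAbove_lt_succAbove_iff] using h

lemma hasStretchingPair_cycleOfWord_last {m : ℕ} (σ : Equiv.Perm (Fin (m + 1))) :
    HasStretchingPair (cycleOfWord (Fin.last (m + 1)) σ) ↔ HasStretchingWord σ ∨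
      ∃ i : Fin m, σ i.succ < σ i.castSucc ∧ σ i.castSucc < σ (Fin.last m) := by
  refine ⟨fun h => ?_, ?_⟩
  · obtain ⟨a, b, h1, h2, h3⟩ := (hasStretchingPair_cycleOfWord _ _).1 h
    cases a using Fin.lastCases with
    | last => rw [insertAt_self] at h2; exact absurd h2 (Fin.le_last _).not_gt
    | cast a =>
    cases b using Fin.lastCases with
    | last => rw [insertAt_self] at h3; exact absurd h3 (Fin.le_last _).not_gt
    | cast b =>
    cases a using Fin.lastCases with
    | last =>
      rw [Fin.coeSucc_eq_succ, Fin.succ_last, insertAt_self] at h1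
      exact absurd h1 (Fin.le_last _).not_gt
    | cast a =>
    rw [insertAt_last_castSucc_castSucc_add_one] at h1
    rw [insertAt_last_castSucc, Fin.succAbove_lt_succAbove_iff] at h1
    rw [insertAt_last_castSucc, insertAt_last_castSucc, Fin.succAbove_lt_succAbove_iff] at h2
    cases b using Fin.lastCases with
    | last => exact Or.inr ⟨a, h1, h2⟩
    | cast b =>
      rw [insertAt_last_castSucc_castSucc_add_one, insertAt_last_castSucc,
        Fin.succAbove_lt_succAbove_iff] at h3
      exact Or.inl ⟨a, b, h1, h2, h3⟩
  · rintro (h | ⟨i, h1, h2⟩)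
    · exact h.hasStretchingPair _
    · rw [hasStretchingPair_cycleOfWord]
      refine ⟨i.castSucc.castSucc, (Fin.last m).castSucc, ?_⟩
      rw [insertAt_last_castSucc_castSucc_add_one, Fin.coeSucc_eq_succ, Fin.succ_last,
        insertAt_self]
      simp only [insertAt_last_castSucc, Fin.succAbove_lt_succAbove_iff]
      refine ⟨h1, h2, ?_⟩
      simp [Fin.castSucc_lt_last]

lemma exists_of_hasStretchingPair_cycleOfWord_zero {m : ℕ} {σ : Equiv.Perm (Fin (m + 1))}
    (h : HasStretchingPair (cycleOfWord 0 σ)) : HasStretchingWord σ ∨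
      ∃ j : Fin m, σ (Fin.last m) < σ j.castSucc ∧ σ j.castSucc < σ j.succ := by
  obtain ⟨a, b, h1, h2, h3⟩ := (hasStretchingPair_cycleOfWord _ _).1 h
  cases a using Fin.lastCases with
  | last => rw [insertAt_self] at h1; exact absurd h1 (Fin.zero_le _).not_gt
  | cast a =>
  cases b using Fin.lastCases with
  | last => rw [insertAt_self] at h2; exact absurd h2 (Fin.zero_le _).not_gt
  | cast b =>
  cases b using Fin.lastCases with
  | last =>
    rw [Fin.coeSucc_eq_succ, Fin.succ_last, insertAt_self] at h3
    exact absurd h3 (Fin.zero_le _).not_gt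
  | cast b =>
  rw [insertAt_last_castSucc_castSucc_add_one] at h3
  rw [insertAt_last_castSucc, insertAt_last_castSucc, Fin.succAbove_lt_succAbove_iff] at h2
  rw [insertAt_last_castSucc, Fin.succAbove_lt_succAbove_iff] at h3
  cases a using Fin.lastCases with
  | last => exact Or.inr ⟨b, h2, h3⟩
  | cast a =>
    rw [insertAt_last_castSucc_castSucc_add_one, insertAt_last_castSucc,
      Fin.succAbove_lt_succAbove_iff] at h1
    exact Or.inl ⟨a, b, h1, h2, h3⟩

lemma hasStretchingWord_iff {m : ℕ} (σ : Equiv.Perm (Fin (m + 1))) :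
    HasStretchingWord σ ↔ Contains2134 σ ∨ Contains3421 σ := by
  constructor
  · rintro ⟨⟨i, hi⟩, ⟨j, hj⟩, h1, h2, h3⟩
    simp only [Fin.succ_mk, Fin.castSucc_mk] at h1 h2 h3
    rcases lt_trichotomy i j with hij | rfl | hij
    · rcases (Nat.succ_le_of_lt hij).eq_or_lt with rfl | hij
      · exact absurd (h1.trans h2) (lt_irrefl _)
      · exact Or.inl ⟨i, j, hij, by omega, h1, h2, h3⟩
    · exact absurd h2 (lt_irrefl _)
    · rcases (Nat.succ_le_of_lt hij).eq_or_lt with rfl | hij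
      · exact absurd (h2.trans h3) (lt_irrefl _)
      · exact Or.inr ⟨j, i, hij, by omega, h1, h2, h3⟩
  · rintro (⟨i, j, h1, h2, h⟩ | ⟨i, j, h1, h2, h⟩)
    · exact ⟨⟨i, by omega⟩, ⟨j, by omega⟩, h⟩
    · exact ⟨⟨j, by omega⟩, ⟨i, by omega⟩, h⟩

lemma ncard_stretchFree_cycleOfWord {m : ℕ} (p : Fin (m + 2)) :
    {σ | ¬ HasStretchingPair (cycleOfWord p σ)}.ncard = cStarCard (m + 2) := by
  rw [← Set.ncard_image_of_injective _ (cycleOfWord_injective p), ← Nat.card_coe_set_eq,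
    cStarCard]
  congr! 3 with π
  constructor
  · rintro ⟨σ, hσ, rfl⟩
    exact ⟨cycleOfWord_isCycle p σ, card_support_cycleOfWord p σ, hσ⟩
  · rintro ⟨h1, h2, h3⟩
    obtain ⟨σ, rfl⟩ := exists_cycleOfWord_eq p h1 h2
    exact ⟨σ, h3, rfl⟩

lemma avoidCount_eq (m : ℕ) :
    avoidCount (m + 1) = {σ : Equiv.Perm (Fin (m + 1)) | ¬ HasStretchingWord σ}.ncard := by
  rw [avoidCount, ← Nat.card_coe_set_eq]
  simp only [hasStretchingWord_iff, not_or]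
  rfl

lemma HasStretchingPair.of_insertAt {m : ℕ} {σ : Equiv.Perm (Fin (m + 1))}
    (h : HasStretchingPair (cycleOfWord (Fin.last (m + 2)) (insertAt 0 (Fin.last (m + 1)) σ))) :
    HasStretchingPair (cycleOfWord (Fin.last (m + 1)) σ) := by
  rw [hasStretchingPair_cycleOfWord_last] at h ⊢
  rcases h with ⟨i, j, h1, h2, h3⟩ | ⟨i, h1, h2⟩
  · cases i using Fin.cases with
    | zero =>
      rw [Fin.castSucc_zero, insertAt_self] at h2
      exact absurd h2 (Fin.le_last _).not_gt
    | succ i =>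
    cases j using Fin.cases with
    | zero =>
      rw [Fin.castSucc_zero, insertAt_self] at h3
      exact absurd h3 (Fin.le_last _).not_gt
    | succ j =>
    simp only [← Fin.succ_castSucc, insertAt_zero_succ, Fin.succAbove_lt_succAbove_iff]
      at h1 h2 h3
    exact Or.inl ⟨i, j, h1, h2, h3⟩
  · cases i using Fin.cases with
    | zero =>
      rw [Fin.castSucc_zero, insertAt_self] at h2
      exact absurd h2 (Fin.le_last _).not_gt
    | succ i =>
    rw [← Fin.succ_last] at h2
    simp only [← Fin.succ_castSucc, insertAt_zero_succ, Fin.succAbove_lt_succAbove_iff] at h1 h2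
    exact Or.inr ⟨i, h1, h2⟩

lemma cStarCard_le_succ (m : ℕ) : cStarCard (m + 2) ≤ cStarCard (m + 3) := by
  rw [← ncard_stretchFree_cycleOfWord (Fin.last (m + 1)),
    ← ncard_stretchFree_cycleOfWord (Fin.last (m + 2))]
  exact Set.ncard_le_ncard_of_injOn (insertAt 0 (Fin.last (m + 1)))
    (fun σ hσ h => hσ (HasStretchingPair.of_insertAt h)) (insertAt_injective _ _).injOn

lemma cStarCard_le_avoidCount (m : ℕ) : cStarCard (m + 2) ≤ avoidCount (m + 1) := by
  rw [← ncard_stretchFree_cycleOfWord (Fin.last (m + 1)), avoidCount_eq]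
  exact Set.ncard_le_ncard fun σ hσ h => hσ (h.hasStretchingPair _)

lemma avoidCount_le_two_mul_cStarCard (m : ℕ) :
    avoidCount (m + 1) ≤ cStarCard (m + 2) + cStarCard (m + 2) := by
  nth_rw 1 [← ncard_stretchFree_cycleOfWord (Fin.last (m + 1)),
    ← ncard_stretchFree_cycleOfWord (0 : Fin (m + 2))]
  rw [avoidCount_eq]
  refine (Set.ncard_le_ncard fun σ hσ => ?_).trans (Set.ncard_union_le _ _)
  by_contra h
  simp only [Set.mem_union, Set.mem_ofPred_eq, not_or, not_not] at h
  obtain ⟨i, hi⟩ := ((hasStretchingPair_cycleOfWord_last σ).1 h.1).resolve_left hσ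
  obtain ⟨j, hj⟩ := (exists_of_hasStretchingPair_cycleOfWord_zero h.2).resolve_left hσ
  exact hσ ⟨i, j, hi.1, hi.2.trans hj.1, hj.2⟩

theorem stmt6 (n : ℕ) (hn : 0 < n) :
    cStarCard (n + 1) ≤ avoidCount n ∧
    avoidCount n ≤ cStarCard (n + 1) + cStarCard (n + 2) ∧
    cStarCard (n + 1) + cStarCard (n + 2) ≤ 2 * cStarCard (n + 2) := by
  obtain ⟨m, rfl⟩ := Nat.exists_eq_add_one.2 hn
  have h1 : cStarCard (m + 1 + 1) ≤ cStarCard (m + 1 + 2) := cStarCard_le_succ m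
  have h2 : avoidCount (m + 1) ≤ cStarCard (m + 1 + 1) + cStarCard (m + 1 + 1) :=
    avoidCount_le_two_mul_cStarCard m
  exact ⟨cStarCard_le_avoidCount m, by omega, by omega⟩
end

section
/- The function f : (0,∞) → (0,∞) given by f(t) = (1 − e^t)·log(1 − e^{−t}) / t is a strictly decreasing bijection from (0,∞) onto (0,∞); that is, f maps (0,∞) into (0,∞), f is strictly antitone on (0,∞), and every y > 0 equals f(t) for exactly one t > 0. -/
/-- `f(t) = (1 - e^t) log(1 - e^{-t}) / t`. -/
noncomputable def fFun (t : ℝ) : ℝ :=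
  (1 - Real.exp t) * Real.log (1 - Real.exp (-t)) / t

theorem neg_log_one_sub_div_pos {x : ℝ} (hx : x ∈ Set.Ioo (0 : ℝ) 1) :
    0 < -Real.log (1 - x) / x :=
  div_pos (neg_pos.2 (Real.log_neg (by linarith [hx.2]) (by linarith [hx.1]))) hx.1

theorem strictMonoOn_neg_log_one_sub_div :
    StrictMonoOn (fun x : ℝ => -Real.log (1 - x) / x) (Set.Ioo 0 1) := by
  intro x hx y hy hxy
  have h := strictConcaveOn_log_Ioi.secant_strict_mono (a := 1) (x := 1 - y) (y := 1 - x)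
    (Set.mem_Ioi.2 one_pos) (Set.mem_Ioi.2 (by linarith [hy.2]))
    (Set.mem_Ioi.2 (by linarith [hx.2])) (by linarith [hy.1]) (by linarith [hx.1])
    (by linarith)
  have key (z : ℝ) : (Real.log (1 - z) - Real.log 1) / (1 - z - 1) = -Real.log (1 - z) / z := by
    rw [Real.log_one, sub_zero, show 1 - z - 1 = -z by ring, div_neg, neg_div]
  rwa [key, key] at h

theorem exp_neg_mem_Ioo {t : ℝ} (ht : 0 < t) : Real.exp (-t) ∈ Set.Ioo (0 : ℝ) 1 :=
  ⟨Real.exp_pos _, Real.exp_lt_one_iff.2 (by linarith)⟩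

theorem one_sub_exp_neg_mem_Ioo {t : ℝ} (ht : 0 < t) :
    1 - Real.exp (-t) ∈ Set.Ioo (0 : ℝ) 1 :=
  ⟨by linarith [(exp_neg_mem_Ioo ht).2], by linarith [(exp_neg_mem_Ioo ht).1]⟩

theorem fFun_eq_div {t : ℝ} (ht : 0 < t) :
    fFun t = (-Real.log (1 - Real.exp (-t)) / Real.exp (-t)) /
      (-Real.log (1 - (1 - Real.exp (-t))) / (1 - Real.exp (-t))) := by
  have h := (one_sub_exp_neg_mem_Ioo ht).1.ne'
  rw [sub_sub_cancel, Real.log_exp, neg_neg, fFun]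
  rw [Real.exp_neg] at h ⊢
  have := Real.exp_pos t
  field_simp
  ring

theorem fFun_pos {t : ℝ} (ht : 0 < t) : 0 < fFun t := by
  rw [fFun_eq_div ht]
  exact div_pos (neg_log_one_sub_div_pos (exp_neg_mem_Ioo ht))
    (neg_log_one_sub_div_pos (one_sub_exp_neg_mem_Ioo ht))

theorem strictAntiOn_fFun : StrictAntiOn fFun (Set.Ioi 0) := by
  intro s hs t ht hst
  have hlt : Real.exp (-t) < Real.exp (-s) := Real.exp_lt_exp.2 (by linarith)
  rw [fFun_eq_div hs, fFun_eq_div ht]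
  exact div_lt_div₀
    (strictMonoOn_neg_log_one_sub_div (exp_neg_mem_Ioo ht) (exp_neg_mem_Ioo hs) hlt)
    (strictMonoOn_neg_log_one_sub_div (one_sub_exp_neg_mem_Ioo hs)
      (one_sub_exp_neg_mem_Ioo ht) (by linarith)).le
    (neg_log_one_sub_div_pos (exp_neg_mem_Ioo hs)).le
    (neg_log_one_sub_div_pos (one_sub_exp_neg_mem_Ioo hs))

theorem continuousOn_fFun : ContinuousOn fFun (Set.Ioi 0) := by
  unfold fFun
  refine ContinuousOn.div (ContinuousOn.mul (by fun_prop) (ContinuousOn.log (by fun_prop) ?_))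
    (by fun_prop) fun t ht => ne_of_gt ht
  exact fun t ht => (one_sub_exp_neg_mem_Ioo ht).1.ne'

theorem neg_log_one_sub_exp_neg_le_fFun {t : ℝ} (ht : 0 < t) :
    -Real.log (1 - Real.exp (-t)) ≤ fFun t := by
  have hx := one_sub_exp_neg_mem_Ioo ht
  rw [fFun, le_div_iff₀ ht]
  nlinarith [Real.log_neg hx.1 hx.2, Real.add_one_le_exp t]

theorem fFun_le_inv {t : ℝ} (ht : 0 < t) : fFun t ≤ t⁻¹ := by
  have hx := one_sub_exp_neg_mem_Ioo ht
  rw [fFun, inv_eq_one_div]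
  refine div_le_div_of_nonneg_right ?_ ht.le
  have hl := Real.one_sub_inv_le_log_of_pos hx.1
  have he : 0 < Real.exp t - 1 := by linarith [Real.add_one_le_exp t]
  have h : (Real.exp t - 1) * (1 - (1 - Real.exp (-t))⁻¹) = -1 := by
    have := Real.exp_pos t
    rw [Real.exp_neg, show 1 - (Real.exp t)⁻¹ = (Real.exp t - 1) / Real.exp t by field_simp]
    field_simp
    ring
  nlinarith [mul_le_mul_of_nonneg_left hl he.le]

theorem surjOn_fFun : Set.SurjOn fFun (Set.Ioi 0) (Set.Ioi 0) := by
  intro y (hy : 0 < y)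
  have hx := one_sub_exp_neg_mem_Ioo hy
  have ht : 0 < -Real.log (1 - Real.exp (-y)) := neg_pos.2 (Real.log_neg hx.1 hx.2)
  have hlow : fFun y⁻¹ ≤ y := (fFun_le_inv (inv_pos.2 hy)).trans_eq (inv_inv y)
  have hhigh : y ≤ fFun (-Real.log (1 - Real.exp (-y))) := by
    have h := neg_log_one_sub_exp_neg_le_fFun ht
    rwa [neg_neg, Real.exp_log hx.1, sub_sub_cancel, Real.log_exp, neg_neg] at h
  exact isPreconnected_Ioi.intermediate_value (Set.mem_Ioi.2 (inv_pos.2 hy))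
    (Set.mem_Ioi.2 ht) continuousOn_fFun ⟨hlow, hhigh⟩

theorem stmt7 :
    (∀ t : ℝ, 0 < t → 0 < fFun t) ∧
    StrictAntiOn fFun (Set.Ioi 0) ∧
    (∀ y : ℝ, 0 < y → ∃! t : ℝ, 0 < t ∧ fFun t = y) := by
  refine ⟨fun t => fFun_pos, strictAntiOn_fFun, fun y hy => ?_⟩
  obtain ⟨t, ht, rfl⟩ := surjOn_fFun hy
  exact ⟨t, ⟨ht, rfl⟩, fun s hs => strictAntiOn_fFun.injOn hs.1 ht hs.2⟩
end

section
/- Let x, y > 0 be real numbers with e^{−x} + e^{−y} = 1. Then y·e^{−y} + x·e^{−x} − x·y > 0, and consequently Q(x,y) = x·y·e^{−x−y}·[y·e^{−y} + x·e^{−x} − x·y·(e^{−y} + e^{−x})] > 0. -/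
/-- For `t > 0`, the bound `t / 2 ≤ sinh (t / 2)` rewritten in terms of `e⁻ᵗ`. -/
theorem mul_exp_neg_half_le {t : ℝ} (ht : 0 < t) :
    t * Real.exp (-(t / 2)) ≤ 1 - Real.exp (-t) := by
  have h : t / 2 ≤ Real.sinh (t / 2) := Real.self_le_sinh_iff.2 (by positivity)
  rw [Real.sinh_eq] at h
  have h₁ : Real.exp (t / 2) * Real.exp (-(t / 2)) = 1 := by
    rw [← Real.exp_add, add_neg_cancel, Real.exp_zero]
  have h₂ : Real.exp (-(t / 2)) * Real.exp (-(t / 2)) = Real.exp (-t) := by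
    rw [← Real.exp_add]; ring_nf
  nlinarith [mul_le_mul_of_nonneg_right h (Real.exp_pos (-(t / 2))).le]

theorem stmt11 (x y : ℝ) (hx : 0 < x) (hy : 0 < y)
    (hxy : Real.exp (-x) + Real.exp (-y) = 1) :
    0 < y * Real.exp (-y) + x * Real.exp (-x) - x * y ∧
    0 < x * y * Real.exp (-x - y) *
        (y * Real.exp (-y) + x * Real.exp (-x) -
          x * y * (Real.exp (-y) + Real.exp (-x))) := by
  have key : 0 < y * Real.exp (-y) + x * Real.exp (-x) - x * y := by
    have hx₁ : x * Real.exp (-(x / 2)) ≤ Real.exp (-y) := by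
      linarith [mul_exp_neg_half_le hx]
    have hy₁ : y * Real.exp (-(y / 2)) ≤ Real.exp (-x) := by
      linarith [mul_exp_neg_half_le hy]
    have hx₂ : Real.exp (-x) < Real.exp (-(x / 2)) := Real.exp_lt_exp.2 (by linarith)
    have hy₂ : Real.exp (-y) < Real.exp (-(y / 2)) := Real.exp_lt_exp.2 (by linarith)
    have hsum : 1 < Real.exp (-(x / 2)) + Real.exp (-(y / 2)) := by linarith
    linarith [mul_le_mul_of_nonneg_left hx₁ hy.le, mul_le_mul_of_nonneg_left hy₁ hx.le,
      mul_lt_mul_of_pos_left hsum (mul_pos hx hy)]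
  refine ⟨key, ?_⟩
  rw [add_comm (Real.exp (-y)) (Real.exp (-x)), hxy, mul_one]
  positivity
end

section
/- For every positive integer n there exists a bijection Φ : S_n → S_n such that for every π ∈ S_n, Exc(π) = DesBot(Φ(π)). -/
/-- The excedance set `Exc(π) = {i ∈ {1,…,n-1} : π(i) > i}` of `π ∈ S_n`, as a set of
1-indexed positions (position `i : Fin n` corresponds to `i + 1 ∈ {1,…,n}`; the last
position can never be an excedance). -/
def excSet {n : ℕ} (π : Equiv.Perm (Fin n)) : Finset ℕ :=
  (Finset.univ.filter (fun i : Fin n => i < π i)).image (fun i : Fin n => (i : ℕ) + 1)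

/-- The descent bottoms set `DesBot(π) = {π(i) : 2 ≤ i ≤ n, π(i) < π(i-1)}` of `π ∈ S_n`,
as a set of 1-indexed values. -/
def desBotSet {n : ℕ} (π : Equiv.Perm (Fin n)) : Finset ℕ :=
  (Finset.univ.filter (fun i : Fin n =>
      0 < (i : ℕ) ∧ π i < π ⟨(i : ℕ) - 1, lt_of_le_of_lt (Nat.sub_le _ _) i.isLt⟩)).image
    (fun i : Fin n => (π i : ℕ) + 1)

theorem mem_excSet {n : ℕ} {π : Equiv.Perm (Fin n)} {m : ℕ} :
    m ∈ excSet π ↔ ∃ i : Fin n, i < π i ∧ (i : ℕ) + 1 = m := by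
  simp [excSet]

theorem mem_desBotSet {n : ℕ} {π : Equiv.Perm (Fin n)} {m : ℕ} :
    m ∈ desBotSet π ↔
      ∃ a b : Fin n, (a : ℕ) + 1 = b ∧ π b < π a ∧ (π b : ℕ) + 1 = m := by
  simp only [desBotSet, Finset.mem_image, Finset.mem_filter, Finset.mem_univ, true_and]
  constructor
  · rintro ⟨i, ⟨hi, hlt⟩, rfl⟩
    exact ⟨_, i, by simp only; omega, hlt, rfl⟩
  · rintro ⟨a, b, hab, hlt, rfl⟩
    have ha : (⟨(b : ℕ) - 1, lt_of_le_of_lt (Nat.sub_le _ _) b.isLt⟩ : Fin n) = a :=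
      Fin.ext (by simp only; omega)
    exact ⟨b, ⟨by omega, ha ▸ hlt⟩, rfl⟩

/-- Insert the new largest letter at position `k` of the word `σ 0, …, σ (n - 1)`. -/
def insertMax {n : ℕ} (k : Fin (n + 1)) (σ : Equiv.Perm (Fin n)) : Equiv.Perm (Fin (n + 1)) :=
  ((finSuccEquiv' k).trans σ.optionCongr).trans (finSuccEquiv' (Fin.last n)).symm

@[simp]
theorem insertMax_self {n : ℕ} (k : Fin (n + 1)) (σ : Equiv.Perm (Fin n)) :
    insertMax k σ k = Fin.last n := by
  simp [insertMax]

@[simp]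
theorem insertMax_succAbove {n : ℕ} (k : Fin (n + 1)) (σ : Equiv.Perm (Fin n)) (m : Fin n) :
    insertMax k σ (k.succAbove m) = (σ m).castSucc := by
  simp [insertMax]

@[simp]
theorem insertMax_last_castSucc {n : ℕ} (σ : Equiv.Perm (Fin n)) (m : Fin n) :
    insertMax (Fin.last n) σ m.castSucc = (σ m).castSucc := by
  simpa using insertMax_succAbove (Fin.last n) σ m

theorem insertMax_inj {n : ℕ} {k l : Fin (n + 1)} {σ τ : Equiv.Perm (Fin n)} :
    insertMax k σ = insertMax l τ ↔ k = l ∧ σ = τ := by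
  refine ⟨fun h => ?_, by rintro ⟨rfl, rfl⟩; rfl⟩
  have hkl : k = l := (insertMax l τ).injective (by rw [← h, insertMax_self, h, insertMax_self])
  subst hkl
  refine ⟨rfl, Equiv.ext fun m => Fin.castSucc_injective n ?_⟩
  rw [← insertMax_succAbove k σ, h, insertMax_succAbove]

/-- Insert the new largest letter just before the letter `i` of the word `σ`, or at the end. -/
def insertBefore {n : ℕ} : Option (Fin n) × Equiv.Perm (Fin n) → Equiv.Perm (Fin (n + 1))
  | (none, σ) => insertMax (Fin.last n) σ
  | (some i, σ) => insertMax (σ.symm i).castSucc σ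

/-- Insert the new largest point just after the point `i` in its cycle of `σ`, or as a fixed
point. -/
def insertCycle {n : ℕ} : Option (Fin n) × Equiv.Perm (Fin n) → Equiv.Perm (Fin (n + 1))
  | (none, σ) => insertMax (Fin.last n) σ
  | (some i, σ) => insertMax (Fin.last n) σ * Equiv.swap i.castSucc (Fin.last n)

theorem card_option_prod_perm (n : ℕ) :
    Fintype.card (Option (Fin n) × Equiv.Perm (Fin n)) =
      Fintype.card (Equiv.Perm (Fin (n + 1))) := by
  simp [Fintype.card_perm, Nat.factorial_succ]

theorem insertBefore_bijective (n : ℕ) : Function.Bijective (insertBefore (n := n)) := by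
  rw [Fintype.bijective_iff_injective_and_card]
  refine ⟨?_, card_option_prod_perm n⟩
  rintro ⟨_ | i, σ⟩ ⟨_ | j, τ⟩ h <;> obtain ⟨hk, rfl⟩ := insertMax_inj.1 h
  · rfl
  · exact absurd hk.symm (Fin.castSucc_ne_last _)
  · exact absurd hk (Fin.castSucc_ne_last _)
  · simpa using hk

theorem insertCycle_bijective (n : ℕ) : Function.Bijective (insertCycle (n := n)) := by
  rw [Fintype.bijective_iff_injective_and_card]
  refine ⟨?_, card_option_prod_perm n⟩
  have preimage_max : ∀ (o : Option (Fin n)) (σ : Equiv.Perm (Fin n)),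
      insertCycle (o, σ) ((finSuccEquiv' (Fin.last n)).symm o) = Fin.last n := by
    rintro (_ | i) σ <;> simp [insertCycle]
  rintro ⟨o, σ⟩ ⟨o', τ⟩ h
  obtain rfl : o = o' := (finSuccEquiv' (Fin.last n)).symm.injective <|
    (insertCycle (o', τ)).injective (by rw [preimage_max, ← h, preimage_max])
  cases o with
  | none => rw [(insertMax_inj.1 h).2]
  | some i => rw [(insertMax_inj.1 (mul_right_cancel h)).2]

theorem excSet_insertMax_last {n : ℕ} (σ : Equiv.Perm (Fin n)) :
    excSet (insertMax (Fin.last n) σ) = excSet σ := by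
  ext m
  simp [mem_excSet, Fin.exists_fin_succ']

theorem excSet_insertCycle_some {n : ℕ} (i : Fin n) (σ : Equiv.Perm (Fin n)) :
    excSet (insertCycle (some i, σ)) = insert ((i : ℕ) + 1) (excSet σ) := by
  have apply_castSucc (j : Fin n) : insertCycle (some i, σ) j.castSucc =
      if j = i then Fin.last n else (σ j).castSucc := by
    split_ifs with hj
    · simp [insertCycle, hj]
    · simp [insertCycle, Equiv.swap_apply_of_ne_of_ne
        ((Fin.castSucc_injective n).ne hj) (Fin.castSucc_ne_last j)]
  ext m
  simp only [Finset.mem_insert, mem_excSet, Fin.exists_fin_succ', apply_castSucc]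
  constructor
  · rintro (⟨j, hj, rfl⟩ | ⟨h, -⟩)
    · split_ifs at hj with hji
      · simp [hji]
      · exact Or.inr ⟨j, by simpa using hj, rfl⟩
    · exact absurd h (Fin.le_last _).not_gt
  · rintro (rfl | ⟨j, hj, rfl⟩)
    · exact Or.inl ⟨i, by simp [Fin.castSucc_lt_last], rfl⟩
    · refine Or.inl ⟨j, ?_, rfl⟩
      split_ifs
      · exact Fin.castSucc_lt_last j
      · simpa using hj

theorem desBotSet_insertMax_last {n : ℕ} (σ : Equiv.Perm (Fin n)) :
    desBotSet (insertMax (Fin.last n) σ) = desBotSet σ := by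
  ext m
  simp only [mem_desBotSet, Fin.exists_fin_succ', insertMax_last_castSucc, insertMax_self]
  have : ∀ a : Fin n, ¬ Fin.last n < (σ a).castSucc := fun a => (Fin.le_last _).not_gt
  have h : ∀ b : Fin n, ¬ n + 1 = (b : ℕ) := fun b => by omega
  simp [this, h]

theorem desBotSet_insertMax_castSucc {n : ℕ} (k : Fin n) (σ : Equiv.Perm (Fin n)) :
    desBotSet (insertMax k.castSucc σ) = insert ((σ k : ℕ) + 1) (desBotSet σ) := by
  have val_succAbove (j : Fin n) : (k.castSucc.succAbove j : ℕ) =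
      if (j : ℕ) < k then (j : ℕ) else j + 1 := by
    simp only [Fin.succAbove, Fin.lt_def, Fin.val_castSucc]
    split_ifs <;> simp
  ext m
  simp only [Finset.mem_insert, mem_desBotSet, Fin.exists_iff_succAbove k.castSucc,
    insertMax_self, insertMax_succAbove, val_succAbove, Fin.val_castSucc,
    Fin.castSucc_lt_castSucc_iff]
  constructor
  · rintro ((⟨h, -⟩ | ⟨b, hb, -, rfl⟩) | ⟨a, (⟨-, h, -⟩ | ⟨b, hab, hlt, rfl⟩)⟩)
    · omega
    · obtain rfl : b = k := Fin.ext (by split_ifs at hb <;> omega)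
      exact Or.inl rfl
    · exact absurd h (Fin.le_last _).not_gt
    · exact Or.inr ⟨a, b, by split_ifs at hab <;> omega, hlt, rfl⟩
  · have bottom : ∃ b : Fin n, (k : ℕ) + 1 = (if (b : ℕ) < k then (b : ℕ) else b + 1) ∧
        (σ b).castSucc < Fin.last n ∧ (σ b : ℕ) + 1 = (σ k : ℕ) + 1 :=
      ⟨k, by simp, Fin.castSucc_lt_last _, rfl⟩
    rintro (rfl | ⟨a, b, hab, hlt, rfl⟩)
    · exact Or.inl (Or.inr bottom)
    · by_cases hbk : b = k
      · subst hbk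
        exact Or.inl (Or.inr bottom)
      · have : (b : ℕ) ≠ k := Fin.val_ne_of_ne hbk
        exact Or.inr ⟨a, Or.inr ⟨b, by split_ifs <;> omega, hlt, rfl⟩⟩

theorem exists_equiv_excSet_eq_desBotSet (n : ℕ) :
    ∃ e : Equiv.Perm (Fin n) ≃ Equiv.Perm (Fin n), ∀ π, excSet π = desBotSet (e π) := by
  induction n with
  | zero => exact ⟨Equiv.refl _, fun π => by simp [excSet, desBotSet]⟩
  | succ n ih =>
    obtain ⟨e, he⟩ := ih
    let c := Equiv.ofBijective _ (insertCycle_bijective n)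
    let b := Equiv.ofBijective _ (insertBefore_bijective n)
    refine ⟨(c.symm.trans ((Equiv.refl _).prodCongr e)).trans b, fun π => ?_⟩
    obtain ⟨⟨o, σ⟩, rfl⟩ := c.surjective π
    simp only [Equiv.trans_apply, Equiv.symm_apply_apply]
    cases o with
    | none =>
      exact (excSet_insertMax_last σ).trans ((he σ).trans (desBotSet_insertMax_last (e σ)).symm)
    | some i =>
      refine (excSet_insertCycle_some i σ).trans ?_
      have h := desBotSet_insertMax_castSucc ((e σ).symm i) (e σ)
      rw [Equiv.apply_symm_apply, ← he σ] at h
      exact h.symm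

theorem stmt12 (n : ℕ) (hn : 0 < n) :
    ∃ Φ : Equiv.Perm (Fin n) → Equiv.Perm (Fin n),
      Function.Bijective Φ ∧ ∀ π : Equiv.Perm (Fin n), excSet π = desBotSet (Φ π) := by
  obtain ⟨e, he⟩ := exists_equiv_excSet_eq_desBotSet n
  exact ⟨e, e.bijective, he⟩
end

section
/- Let π ∈ S_{n+1} have no fixed points. Then π admits no stretching pair if and only if there exists ℓ ∈ {1,…,n} such that Exc(π) = {1,…,ℓ}. -/
theorem succ_mem_excSet {n : ℕ} (π : Equiv.Perm (Fin n)) (i : Fin n) :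
    (i : ℕ) + 1 ∈ excSet π ↔ i < π i := by
  simp [excSet, Fin.val_inj]

theorem excSet_eq_Icc_iff {n : ℕ} (π : Equiv.Perm (Fin n)) {l : ℕ} (hl : l ≤ n) :
    excSet π = Finset.Icc 1 l ↔ ∀ i : Fin n, i < π i ↔ (i : ℕ) < l := by
  refine ⟨fun h i => ?_, fun h => ?_⟩
  · rw [← succ_mem_excSet, h, Finset.mem_Icc]
    lia
  · ext m
    simp only [excSet, Finset.mem_image, Finset.mem_filter, Finset.mem_univ, true_and,
      Finset.mem_Icc, h]
    constructor
    · rintro ⟨i, hi, rfl⟩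
      lia
    · rintro ⟨h1, h2⟩
      exact ⟨⟨m - 1, by lia⟩, by simp only; lia, by simp only; lia⟩

theorem stmt13 (n : ℕ) (π : Equiv.Perm (Fin (n + 1))) (hfix : ∀ i, π i ≠ i) :
    ¬ HasStretchingPair π ↔ ∃ ℓ : ℕ, 1 ≤ ℓ ∧ ℓ ≤ n ∧ excSet π = Finset.Icc 1 ℓ := by
  constructor
  · intro h
    obtain ⟨a, ha, hmin⟩ := WellFounded.has_min (wellFounded_lt (α := Fin (n + 1)))
      {i | π i < i} ⟨Fin.last n, lt_of_le_of_ne (Fin.le_last _) (hfix _)⟩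
    have ha' : π a < a := ha
    refine ⟨a, by lia, by lia, (excSet_eq_Icc_iff π (by lia)).2 fun i => ⟨fun hi => ?_, fun hi => ?_⟩⟩
    · by_contra hai
      rcases (not_lt.1 hai).lt_or_eq with hlt | heq
      · exact h ⟨a, i, ha', hlt, hi⟩
      · obtain rfl := Fin.ext heq
        exact lt_asymm ha' hi
    · exact lt_of_le_of_ne (not_lt.1 fun hlt => hmin i hlt hi) (hfix i).symm
  · rintro ⟨l, -, hl, hexc⟩ ⟨i, j, hi, hij, hj⟩
    rw [excSet_eq_Icc_iff π (by lia)] at hexc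
    have hjl : (j : ℕ) < l := (hexc j).1 hj
    exact lt_asymm hi ((hexc i).2 (by lia))
end

section
/- For every positive integer n, |E_{n+1}| ≤ |C*_{n+2}|, where E_{n+1} is the set of (n+1)-cycles π ∈ C_{n+1} all of whose stretching pairs i < j satisfy π(j) = n+1. -/
/-- `|E_{n+1}|`: the number of `(n+1)`-cycles all of whose stretching pairs `i < j`
satisfy `π(j) = n+1` (the top element, which 0-indexed is `Fin.last n`). -/
noncomputable def eCard (n : ℕ) : ℕ :=
  Nat.card {π : Equiv.Perm (Fin (n + 1)) //
    π.IsCycle ∧ π.support.card = n + 1 ∧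
    ∀ i j : Fin (n + 1), π i < i → i < j → j < π j → π j = Fin.last n}

namespace Equiv.Perm

/-- Inserting a new element into a cycle moving every point: if every pair of points lies in the
same cycle of `π`, then all points lie in the cycle of `0` in `decomposeFin.symm ((π a).succ, π)`. -/
theorem sameCycle_decomposeFin_symm {m : ℕ} {π : Perm (Fin m)} (a : Fin m)
    (h : ∀ x y, π.SameCycle x y) (y : Fin (m + 1)) :
    (decomposeFin.symm ((π a).succ, π)).SameCycle 0 y := by
  set σ := decomposeFin.symm ((π a).succ, π) with hσ
  have hzero : σ.SameCycle 0 (π a).succ := ⟨1, by simp [hσ]⟩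
  have hstep (x : Fin m) : σ.SameCycle x.succ (π x).succ := by
    by_cases hx : x = a
    · subst hx
      exact SameCycle.trans ⟨1, by simp [hσ]⟩ hzero
    · refine ⟨1, ?_⟩
      have hne : (π x).succ ≠ (π a).succ := by simpa using hx
      simp [hσ, swap_apply_of_ne_of_ne (Fin.succ_ne_zero _) hne]
  have hpow (k : ℕ) (x : Fin m) : σ.SameCycle x.succ ((π ^ k) x).succ := by
    induction k with
    | zero => exact SameCycle.refl _ _
    | succ k ih =>
      rw [pow_succ', mul_apply]
      exact ih.trans (hstep _)
  cases y using Fin.cases with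
  | zero => exact SameCycle.refl _ _
  | succ y =>
    obtain ⟨k, hk⟩ := (h (π a) y).exists_nat_pow_eq
    exact hk ▸ hzero.trans (hpow k _)

end Equiv.Perm

open Equiv.Perm in
/-- Inserting a new least element right after the last excedance turns a cycle in `E_{n+1}` into
a cycle with no stretching pair. -/
theorem exists_decomposeFin_symm_not_hasStretchingPair {n : ℕ}
    {π : Equiv.Perm (Fin (n + 1))} (hc : π.IsCycle) (hs : π.support.card = n + 1)
    (hE : ∀ i j : Fin (n + 1), π i < i → i < j → j < π j → π j = Fin.last n) :
    ∃ p : Fin (n + 2), (decomposeFin.symm (p, π)).IsCycle ∧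
      (decomposeFin.symm (p, π)).support.card = n + 2 ∧
      ¬ HasStretchingPair (decomposeFin.symm (p, π)) := by
  have hmove (x : Fin (n + 1)) : π x ≠ x := by
    have huniv : π.support = Finset.univ := Finset.eq_univ_of_card _ (by simpa using hs)
    exact mem_support.1 (huniv ▸ Finset.mem_univ x)
  obtain ⟨a, ha, hmax⟩ := (Finset.univ.filter fun x => x < π x).exists_max_image id
    ⟨0, by simpa using Fin.pos_iff_ne_zero.2 (hmove 0)⟩
  simp only [Finset.mem_filter, Finset.mem_univ, true_and, id] at ha hmax
  have hsame := sameCycle_decomposeFin_symm a fun x y => hc.sameCycle (hmove x) (hmove y)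
  refine ⟨(π a).succ, ?_⟩
  set σ := decomposeFin.symm ((π a).succ, π) with hσ
  have hσ0 : σ 0 = (π a).succ := by simp [hσ]
  have hσa : σ a.succ = 0 := by simp [hσ]
  have hσs (x : Fin (n + 1)) (hx : x ≠ a) : σ x.succ = (π x).succ := by
    have hne : (π x).succ ≠ (π a).succ := by simpa using hx
    simp [hσ, Equiv.swap_apply_of_ne_of_ne (Fin.succ_ne_zero _) hne]
  have hσ_ne : σ 0 ≠ 0 := hσ0 ▸ Fin.succ_ne_zero _
  refine ⟨⟨0, hσ_ne, fun y _ => hsame y⟩, ?_, ?_⟩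
  · have huniv : σ.support = Finset.univ := Finset.eq_univ_of_forall fun y =>
      mem_support.2 fun hy => hσ_ne ((hsame y).apply_eq_self_iff.2 hy)
    simp [huniv]
  · rintro ⟨i, j, hi, hij, hj⟩
    cases i using Fin.cases with
    | zero => exact absurd hi (Fin.not_lt_zero _)
    | succ i =>
    cases j using Fin.cases with
    | zero => exact absurd hij (Fin.not_lt_zero _)
    | succ j =>
    have hja : j ≠ a := by
      rintro rfl
      exact absurd (hσa ▸ hj) (Fin.not_lt_zero _)
    rw [hσs j hja, Fin.succ_lt_succ_iff] at hj
    rw [Fin.succ_lt_succ_iff] at hij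
    have hlt : j < a := lt_of_le_of_ne (hmax j hj) hja
    rw [hσs i (hij.trans hlt).ne, Fin.succ_lt_succ_iff] at hi
    exact hja (π.injective ((hE i j hi hij hj).trans (hE i a hi (hij.trans hlt) ha).symm))

theorem stmt15 (n : ℕ) (hn : 0 < n) : eCard n ≤ cStarCard (n + 2) := by
  choose p hp using fun π : {π : Equiv.Perm (Fin (n + 1)) //
      π.IsCycle ∧ π.support.card = n + 1 ∧
      ∀ i j : Fin (n + 1), π i < i → i < j → j < π j → π j = Fin.last n} =>
    exists_decomposeFin_symm_not_hasStretchingPair π.2.1 π.2.2.1 π.2.2.2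
  refine Nat.card_le_card_of_injective
    (fun π => ⟨Equiv.Perm.decomposeFin.symm (p π, π.1), hp π⟩) fun π₁ π₂ h => ?_
  exact Subtype.ext (Prod.ext_iff.1
    (Equiv.Perm.decomposeFin.symm.injective (Subtype.ext_iff.1 h))).2
end

section
/- For every real p > 1, N(p) = p·(log p)·log(p−1) + p·log p + (1−p)·log(p−1) − p·(log p)² > 0. -/
theorem stmt17 (p : ℝ) (hp : 1 < p) :
    0 < p * Real.log p * Real.log (p - 1) + p * Real.log p +
        (1 - p) * Real.log (p - 1) - p * (Real.log p) ^ 2 := by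
  have hp0 : 0 < p := by linarith
  have hq : 0 < p - 1 := by linarith
  have hL : 0 < Real.log p := Real.log_pos hp
  have hLp : Real.log p < p - 1 := Real.log_lt_sub_one_of_pos hp0 hp.ne'
  have hD : 0 < Real.log p - Real.log (p - 1) :=
    sub_pos.2 (Real.log_lt_log hq (by linarith))
  have hDp : (p - 1) * (Real.log p - Real.log (p - 1)) ≤ 1 := by
    have h := Real.log_le_sub_one_of_pos (div_pos hp0 hq)
    rw [Real.log_div hp0.ne' hq.ne'] at h
    calc (p - 1) * (Real.log p - Real.log (p - 1)) ≤ (p - 1) * (p / (p - 1) - 1) := by gcongr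
      _ = 1 := by field_simp; ring
  have h₁ := mul_nonneg hL.le (sub_nonneg.2 hDp)
  have h₂ := mul_pos hD (sub_pos.2 hLp)
  linarith
end
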